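/- For every n ∈ ℕ there exist points X, Y ∈ ℕ^ℕ such that {X} and {Y} are Π⁰₁ subsets of ℕ^ℕ, X is not Turing reducible to Y^{(n)}, and Y is not Turing reducible to X^{(n)}. -/

import Mathlib

namespace Harrington

open scoped Classical

/-- Codes for oracle Turing machines (partial recursive functionals),
    extending `Nat.Partrec.Code` with an `oracle` constructor. -/
inductive OCode : Type
  | zero : OCode
  | succ : OCode
  | left : OCode
  | right : OCode
  | oracle : OCode
  | pair : OCode → OCode → OCode
  | comp : OCode → OCode → OCode
  | prec : OCode → OCode → OCode
  | rfind' : OCode → OCode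

/-- Evaluation of an oracle code relative to a (total) oracle `A`. -/
def evalo (A : ℕ → ℕ) : OCode → ℕ →. ℕ
  | OCode.zero => pure 0
  | OCode.succ => fun n => Part.some (n + 1)
  | OCode.left => fun n => Part.some (Nat.unpair n).1
  | OCode.right => fun n => Part.some (Nat.unpair n).2
  | OCode.oracle => fun n => Part.some (A n)
  | OCode.pair cf cg => fun n => Nat.pair <$> evalo A cf n <*> evalo A cg n
  | OCode.comp cf cg => fun n => evalo A cg n >>= evalo A cf
  | OCode.prec cf cg =>
    Nat.unpaired fun a n =>
      n.rec (evalo A cf a) fun y IH => do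
        let i ← IH
        evalo A cg (Nat.pair a (Nat.pair y i))
  | OCode.rfind' cf =>
    Nat.unpaired fun a m =>
      (Nat.rfind fun n => (fun x => x = 0) <$> evalo A cf (Nat.pair a (n + m))).map (· + m)

/-- The standard enumeration of oracle codes: `OCode.ofNat e` is the `e`-th oracle machine. -/
def OCode.ofNat : ℕ → OCode
  | 0 => OCode.zero
  | 1 => OCode.succ
  | 2 => OCode.left
  | 3 => OCode.right
  | 4 => OCode.oracle
  | n + 5 =>
    have hm : n.div2.div2 < n + 5 := by
      have h1 : n.div2.div2 ≤ n := by
        simp only [Nat.div2_val]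
        exact le_trans (Nat.div_le_self _ _) (Nat.div_le_self _ _)
      omega
    have _m1 : n.div2.div2.unpair.1 < n + 5 := lt_of_le_of_lt (Nat.unpair_left_le _) hm
    have _m2 : n.div2.div2.unpair.2 < n + 5 := lt_of_le_of_lt (Nat.unpair_right_le _) hm
    match n.bodd, n.div2.bodd with
    | false, false => OCode.pair (OCode.ofNat n.div2.div2.unpair.1) (OCode.ofNat n.div2.div2.unpair.2)
    | false, true  => OCode.comp (OCode.ofNat n.div2.div2.unpair.1) (OCode.ofNat n.div2.div2.unpair.2)
    | true,  false => OCode.prec (OCode.ofNat n.div2.div2.unpair.1) (OCode.ofNat n.div2.div2.unpair.2)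
    | true,  true  => OCode.rfind' (OCode.ofNat n.div2.div2)

/-- The Turing jump `A'` of an oracle `A`:  `A'(e) = 1` if the `e`-th machine with
    oracle `A` halts on input `e`, and `A'(e) = 0` otherwise. -/
noncomputable def jump (A : ℕ → ℕ) : ℕ → ℕ :=
  fun e => if (evalo A (OCode.ofNat e) e).Dom then 1 else 0

/-- Iterated Turing jump `A^{(n)}`. -/
noncomputable def jumpIter (A : ℕ → ℕ) : ℕ → (ℕ → ℕ)
  | 0 => A
  | n + 1 => jump (jumpIter A n)

/-- The constant zero function (the trivial oracle `0`). -/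
def zeroF : ℕ → ℕ := fun _ => 0

/-- The `ω`-jump: `X^{(ω)} = {(i,n) : i ∈ X^{(n)}}`, coded via `Nat.pair` and identified
    with its characteristic function. -/
noncomputable def omegaJump (A : ℕ → ℕ) : ℕ → ℕ :=
  fun m => if jumpIter A m.unpair.2 m.unpair.1 ≠ 0 then 1 else 0

/-- The recursive join `A ⊕ B`. -/
def oplus (A B : ℕ → ℕ) : ℕ → ℕ :=
  fun n => if n % 2 = 0 then A (n / 2) else B (n / 2)

/-- Code `c` computes the total function `f` from oracle `A`. -/
def computesFn (A : ℕ → ℕ) (c : OCode) (f : ℕ → ℕ) : Prop :=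
  ∀ n, evalo A c n = Part.some (f n)

/-- Turing reducibility `X ≤_T A` for points of Baire space. -/
def TRedIn (X A : ℕ → ℕ) : Prop := ∃ c : OCode, computesFn A c X

/-- `X` is arithmetical relative to `Y`: `X ≤_T Y^{(n)}` for some `n`. -/
def ArithIn (X Y : ℕ → ℕ) : Prop := ∃ n : ℕ, TRedIn X (jumpIter Y n)

/-- `X` and `Y` are arithmetically equivalent. -/
def ArithEquiv (X Y : ℕ → ℕ) : Prop := ArithIn X Y ∧ ArithIn Y X

/-! ### Strings and trees -/

/-- Strings: finite sequences of natural numbers. -/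
abbrev Str := List ℕ

/-- The initial segment `X↾n` of a point `X` of Baire space. -/
def initSeg (X : ℕ → ℕ) (n : ℕ) : Str := (List.range n).map X

/-- A tree is a set of strings closed under initial segments. -/
def IsTree (T : Set Str) : Prop := ∀ σ τ : Str, σ <+: τ → τ ∈ T → σ ∈ T

/-- `[T]`, the set of paths through `T`. -/
def paths (T : Set Str) : Set (ℕ → ℕ) := {X | ∀ n, initSeg X n ∈ T}

/-- The characteristic function of a set of strings. -/
noncomputable def chi (T : Set Str) : Str → ℕ := fun σ => if σ ∈ T then 1 else 0

/-- A set of strings is `A`-recursive: its characteristic function is computable from `A`. -/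
def SetRecIn (A : ℕ → ℕ) (T : Set Str) : Prop :=
  ∃ c : OCode, ∀ σ : Str, evalo A c (Encodable.encode σ) = Part.some (chi T σ)

/-- `P ⊆ ℕ^ℕ` is `Π^{0,A}_1` : `P = [T]` for some `A`-recursive tree `T`. -/
def IsPi01In (A : ℕ → ℕ) (P : Set (ℕ → ℕ)) : Prop :=
  ∃ T : Set Str, IsTree T ∧ SetRecIn A T ∧ P = paths T

/-- `P ⊆ ℕ^ℕ` is `Π⁰₁` : `P = [T]` for some recursive tree `T`. -/
def IsPi01 (P : Set (ℕ → ℕ)) : Prop := IsPi01In zeroF P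

/-! ### Treemaps -/

/-- `F` is a treemap on the tree `T`: `F(σ⌢⟨i⟩) ⊇ F(σ)⌢⟨i⟩` whenever `σ⌢⟨i⟩ ∈ T`. -/
def IsTreemapOn (T : Set Str) (F : Str → Str) : Prop :=
  ∀ (σ : Str) (i : ℕ), σ ++ [i] ∈ T → (F σ) ++ [i] <+: F (σ ++ [i])

/-- The image tree `F(T) = {τ : ∃ σ ∈ T, τ ⊆ F(σ)}`. -/
def treeImage (F : Str → Str) (T : Set Str) : Set Str :=
  {τ | ∃ σ ∈ T, τ <+: F σ}

/-- The map on paths induced by a treemap: `X ↦ ⋃ₙ F(X↾n)`. -/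
def pathMap (F : Str → Str) (X : ℕ → ℕ) : ℕ → ℕ :=
  fun i => (F (initSeg X (i + 1))).getD i 0

/-- The string function `F` is `A`-recursive on `T` (restriction of a partial
    `A`-recursive function). -/
def FnRecInOn (A : ℕ → ℕ) (F : Str → Str) (T : Set Str) : Prop :=
  ∃ c : OCode, ∀ σ ∈ T, evalo A c (Encodable.encode σ) = Part.some (Encodable.encode (F σ))

/-- `F` maps `P` homeomorphically onto `Q` (subspace topologies from Baire space). -/
def HomeoOn (F : (ℕ → ℕ) → (ℕ → ℕ)) (P Q : Set (ℕ → ℕ)) : Prop :=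
  Set.BijOn F P Q ∧ ContinuousOn F P ∧
    ∃ G : (ℕ → ℕ) → (ℕ → ℕ), Set.InvOn G F P Q ∧ ContinuousOn G Q

/-- `f X ≡_T g X` uniformly for all `X ∈ P`: the Turing reductions are given by
    fixed indices independent of `X`. -/
def UnifEquivOn (P : Set (ℕ → ℕ)) (f g : (ℕ → ℕ) → (ℕ → ℕ)) : Prop :=
  ∃ c d : OCode, ∀ X ∈ P, computesFn (g X) c (f X) ∧ computesFn (f X) d (g X)

/-! ### Standard enumerations -/

/-- `W_e^A`: the `e`-th `A`-recursively enumerable set of strings. -/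
def WA (A : ℕ → ℕ) (e : ℕ) : Set Str :=
  {σ | (evalo A (OCode.ofNat e) (Encodable.encode σ)).Dom}

/-- `T_e^A = {σ : ∀ n ≤ |σ|, σ↾n ∉ W_e^A}`: the standard enumeration of `Π^{0,A}_1` trees. -/
def TA (A : ℕ → ℕ) (e : ℕ) : Set Str :=
  {σ | ∀ n ≤ σ.length, σ.take n ∉ WA A e}

/-- `P_e^A = [T_e^A]`: the standard enumeration of `Π^{0,A}_1` subsets of Baire space. -/
def PA (A : ℕ → ℕ) (e : ℕ) : Set (ℕ → ℕ) := paths (TA A e)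

/-! ### The arithmetical hierarchy on Baire space -/

/-- Prepend a number to a point of Baire space. -/
def consF (k : ℕ) (X : ℕ → ℕ) : ℕ → ℕ := fun i => Nat.casesOn i k fun j => X j

/-- `Σ⁰ₙ` subsets of Baire space.  `Σ⁰₀` sets are the recursive clopen sets
    (depending computably on a fixed finite initial segment), and
    `Σ⁰ₙ₊₁` sets are obtained from `Π⁰ₙ` sets by existential number quantification. -/
def SigmaN : ℕ → Set (ℕ → ℕ) → Prop
  | 0, P => ∃ (k : ℕ) (f : Str → Bool), Computable f ∧ P = {X | f (initSeg X k) = true}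
  | n + 1, P => ∃ Q : Set (ℕ → ℕ), SigmaN n Qᶜ ∧ P = {X | ∃ k : ℕ, consF k X ∈ Q}

/-- `Π⁰ₙ` subsets of Baire space: complements of `Σ⁰ₙ` sets. -/
def PiN (n : ℕ) (P : Set (ℕ → ℕ)) : Prop := SigmaN n Pᶜ

/-- Arithmetical subsets of Baire space: `Π⁰ₙ` for some `n`. -/
def IsArith (P : Set (ℕ → ℕ)) : Prop := ∃ n : ℕ, PiN n P


open Nat.Partrec (Code)
open Encodable (encode decode)

theorem exists_lookup_code : ∃ c : Code, ∀ (γ : List ℕ) (i : ℕ),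
    c.eval (Nat.pair (encode γ) i) = Part.ofOption γ[i]? := by
  have h : Nat.Partrec fun n => Part.ofOption
      ((decode n.unpair.1 : Option (List ℕ)).bind fun l => l[n.unpair.2]?) := by
    refine Partrec.nat_iff.1 (Computable.ofOption (Primrec.to_comp ?_))
    exact Primrec.option_bind (Primrec.decode.comp (Primrec.fst.comp Primrec.unpair))
      (Primrec.list_getElem?.comp Primrec.snd
        (Primrec.snd.comp (Primrec.unpair.comp Primrec.fst)))
  obtain ⟨c, hc⟩ := Code.exists_code.1 h
  exact ⟨c, fun γ i => by simp [hc]⟩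

/-- A code with value `γ[i]` at `(encode γ, i)`, undefined when `i` is out of range. -/
noncomputable def lookupCode : Code := Classical.choose exists_lookup_code

theorem eval_lookupCode (γ : List ℕ) (i : ℕ) :
    lookupCode.eval (Nat.pair (encode γ) i) = Part.ofOption γ[i]? :=
  Classical.choose_spec exists_lookup_code γ i

/-- Replace the oracle of an oracle code by a finite string. -/
noncomputable def OCode.subst (γ : List ℕ) : OCode → Code
  | zero => .zero
  | succ => .succ
  | left => .left
  | right => .right
  | oracle => lookupCode.curry (encode γ)
  | pair c d => .pair (c.subst γ) (d.subst γ)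
  | comp c d => .comp (c.subst γ) (d.subst γ)
  | prec c d => .prec (c.subst γ) (d.subst γ)
  | rfind' c => .rfind' (c.subst γ)

@[simp] theorem initSeg_length (A : ℕ → ℕ) (n : ℕ) : (initSeg A n).length = n := by
  simp [initSeg]

theorem initSeg_getElem? (A : ℕ → ℕ) (n i : ℕ) :
    (initSeg A n)[i]? = if i < n then some (A i) else none := by
  simp only [initSeg, List.getElem?_map]
  split_ifs with h
  · simp [List.getElem?_range h]
  · simp [h]

theorem mem_pair_iff {a b : Part ℕ} {y : ℕ} :
    y ∈ (Nat.pair <$> a <*> b : Part ℕ) ↔ ∃ u ∈ a, ∃ v ∈ b, Nat.pair u v = y := by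
  simp [Seq.seq]

theorem mem_rfind_zero_iff {p : ℕ → Part ℕ} {m y : ℕ} :
    y ∈ (Nat.rfind fun n => (fun x => decide (x = 0)) <$> p n).map (· + m) ↔
      ∃ k, 0 ∈ p k ∧ (∀ i < k, ∃ v ∈ p i, v ≠ 0) ∧ k + m = y := by
  simp only [Part.mem_map_iff]
  refine exists_congr fun k => ?_
  refine (and_congr_left fun _ => Nat.mem_rfind).trans ?_
  rw [and_assoc]
  simp [Part.mem_map_iff]

theorem evalo_of_subst (A : ℕ → ℕ) (n : ℕ) (c : OCode) :
    ∀ x y, y ∈ (c.subst (initSeg A n)).eval x → y ∈ evalo A c x := by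
  induction c with
  | zero => exact fun x y h => h
  | succ => exact fun x y h => h
  | left => exact fun x y h => h
  | right => exact fun x y h => h
  | oracle =>
    intro x y h
    simp only [OCode.subst, Code.eval_curry, eval_lookupCode, initSeg_getElem?,
      Part.mem_ofOption] at h
    split_ifs at h with hx
    · simpa [evalo, eq_comm] using h
    · simp at h
  | pair c d hc hd =>
    intro x y h
    obtain ⟨u, hu, v, hv, rfl⟩ := mem_pair_iff.1 h
    exact mem_pair_iff.2 ⟨u, hc _ _ hu, v, hd _ _ hv, rfl⟩
  | comp c d hc hd =>
    intro x y h
    obtain ⟨u, hu, hy⟩ := Part.mem_bind_iff.1 h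
    exact Part.mem_bind_iff.2 ⟨u, hd _ _ hu, hc _ _ hy⟩
  | prec c d hc hd =>
    intro x y h
    simp only [OCode.subst, Code.eval, evalo, Nat.unpaired] at h ⊢
    generalize x.unpair.2 = k at h ⊢
    induction k generalizing y with
    | zero => exact hc _ _ h
    | succ k ih =>
      obtain ⟨u, hu, hy⟩ := Part.mem_bind_iff.1 h
      exact Part.mem_bind_iff.2 ⟨u, ih _ hu, hd _ _ hy⟩
  | rfind' c hc =>
    intro x y h
    obtain ⟨k, hk, h2, rfl⟩ := mem_rfind_zero_iff.1 h
    refine mem_rfind_zero_iff.2 ⟨k, hc _ _ hk, fun i hi => ?_, rfl⟩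
    obtain ⟨v, hv, hv'⟩ := h2 i hi
    exact ⟨v, hc _ _ hv, hv'⟩

open Filter in
theorem eventually_subst_of_evalo (A : ℕ → ℕ) (c : OCode) :
    ∀ x y, y ∈ evalo A c x → ∀ᶠ n in atTop, y ∈ (c.subst (initSeg A n)).eval x := by
  induction c with
  | zero => exact fun x y h => .of_forall fun _ => h
  | succ => exact fun x y h => .of_forall fun _ => h
  | left => exact fun x y h => .of_forall fun _ => h
  | right => exact fun x y h => .of_forall fun _ => h
  | oracle =>
    intro x y h
    filter_upwards [eventually_gt_atTop x] with n hn
    rw [OCode.subst, Code.eval_curry, eval_lookupCode, initSeg_getElem?, if_pos hn]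
    exact h
  | pair c d hc hd =>
    intro x y h
    obtain ⟨u, hu, v, hv, rfl⟩ := mem_pair_iff.1 h
    filter_upwards [hc _ _ hu, hd _ _ hv] with n h1 h2
    exact mem_pair_iff.2 ⟨u, h1, v, h2, rfl⟩
  | comp c d hc hd =>
    intro x y h
    obtain ⟨u, hu, hy⟩ := Part.mem_bind_iff.1 h
    filter_upwards [hd _ _ hu, hc _ _ hy] with n h1 h2
    exact Part.mem_bind_iff.2 ⟨u, h1, h2⟩
  | prec c d hc hd =>
    intro x y h
    simp only [OCode.subst, Code.eval, evalo, Nat.unpaired] at h ⊢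
    generalize x.unpair.2 = k at h ⊢
    induction k generalizing y with
    | zero => exact hc _ _ h
    | succ k ih =>
      obtain ⟨u, hu, hy⟩ := Part.mem_bind_iff.1 h
      filter_upwards [ih _ hu, hd _ _ hy] with n h1 h2
      exact Part.mem_bind_iff.2 ⟨u, h1, h2⟩
  | rfind' c hc =>
    intro x y h
    obtain ⟨k, hk, h2, rfl⟩ := mem_rfind_zero_iff.1 h
    have h3 : ∀ᶠ n in atTop, ∀ i < k, ∃ v ∈ (c.subst (initSeg A n)).eval
        (Nat.pair x.unpair.1 (i + x.unpair.2)), v ≠ 0 := by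
      refine (Set.finite_lt_nat k).eventually_all.2 fun i hi => ?_
      obtain ⟨v, hv, hv'⟩ := h2 i hi
      filter_upwards [hc _ _ hv] with n h1
      exact ⟨v, h1, hv'⟩
    filter_upwards [hc _ _ hk, h3] with n h4 h5
    exact mem_rfind_zero_iff.2 ⟨k, h4, h5, rfl⟩

theorem mem_evalo_iff (A : ℕ → ℕ) (c : OCode) (x y : ℕ) :
    y ∈ evalo A c x ↔ ∃ n, y ∈ (c.subst (initSeg A n)).eval x :=
  ⟨fun h => (eventually_subst_of_evalo A c x y h).exists,
    fun ⟨n, h⟩ => evalo_of_subst A n c x y h⟩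

theorem OCode.ofNat_add_five (n : ℕ) : OCode.ofNat (n + 5) = match n.bodd, n.div2.bodd with
    | false, false => OCode.pair (OCode.ofNat n.div2.div2.unpair.1)
        (OCode.ofNat n.div2.div2.unpair.2)
    | false, true => OCode.comp (OCode.ofNat n.div2.div2.unpair.1)
        (OCode.ofNat n.div2.div2.unpair.2)
    | true, false => OCode.prec (OCode.ofNat n.div2.div2.unpair.1)
        (OCode.ofNat n.div2.div2.unpair.2)
    | true, true => OCode.rfind' (OCode.ofNat n.div2.div2) := by
  rw [OCode.ofNat]

theorem primrec_subst_ofNat : Primrec₂ fun (γ : List ℕ) (e : ℕ) => (OCode.ofNat e).subst γ := by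
  let main : List ℕ → List Code → Option Code := fun _ l =>
    let m := l.length - 5
    let k := m.div2.div2
    l[k.unpair.1]?.bind fun a => l[k.unpair.2]?.bind fun b => l[k]?.bind fun c =>
      some (bif m.bodd then (bif m.div2.bodd then .rfind' c else .prec a b)
        else (bif m.div2.bodd then .comp a b else .pair a b))
  have hmain : Primrec₂ main := by
    have hm : Primrec fun p : List ℕ × List Code => p.2.length - 5 :=
      Primrec.nat_sub.comp (Primrec.list_length.comp Primrec.snd) (Primrec.const 5)
    have hk : Primrec fun p : List ℕ × List Code => (p.2.length - 5).div2.div2 :=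
      Primrec.nat_div2.comp (Primrec.nat_div2.comp hm)
    refine Primrec.option_bind (Primrec.list_getElem?.comp Primrec.snd
      (Primrec.fst.comp (Primrec.unpair.comp hk))) (Primrec₂.mk ?_)
    refine Primrec.option_bind (Primrec.list_getElem?.comp (Primrec.snd.comp Primrec.fst)
      (Primrec.snd.comp (Primrec.unpair.comp (hk.comp Primrec.fst)))) (Primrec₂.mk ?_)
    refine Primrec.option_bind (Primrec.list_getElem?.comp (Primrec.snd.comp
      (Primrec.fst.comp Primrec.fst)) (hk.comp (Primrec.fst.comp Primrec.fst))) (Primrec₂.mk ?_)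
    have hb : Primrec fun q : ((((List ℕ × List Code) × Code) × Code) × Code) => q.1.1.1 :=
      Primrec.fst.comp (Primrec.fst.comp Primrec.fst)
    have ha : Primrec fun q : ((((List ℕ × List Code) × Code) × Code) × Code) => q.1.1.2 :=
      Primrec.snd.comp (Primrec.fst.comp Primrec.fst)
    have hb' : Primrec fun q : ((((List ℕ × List Code) × Code) × Code) × Code) => q.1.2 :=
      Primrec.snd.comp Primrec.fst
    have h1 := Primrec.nat_bodd.comp (hm.comp hb)
    have h2 := Primrec.nat_bodd.comp (Primrec.nat_div2.comp (hm.comp hb))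
    exact Primrec.option_some.comp (Primrec.cond h1
      (Primrec.cond h2 (Code.primrec_rfind'.comp Primrec.snd) (Code.primrec₂_prec.comp ha hb'))
      (Primrec.cond h2 (Code.primrec₂_comp.comp ha hb') (Code.primrec₂_pair.comp ha hb')))
  refine Primrec.nat_strong_rec _ (g := fun γ l =>
    if l.length = 0 then some .zero else if l.length = 1 then some .succ else
    if l.length = 2 then some .left else if l.length = 3 then some .right else
    if l.length = 4 then some (lookupCode.curry (encode γ)) else main γ l) ?_ ?_
  · have hlen (i : ℕ) : PrimrecPred fun p : List ℕ × List Code => p.2.length = i :=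
      Primrec.eq.comp (Primrec.list_length.comp Primrec.snd) (Primrec.const i)
    refine Primrec₂.mk ?_
    refine Primrec.ite (hlen 0) (Primrec.const _) <| Primrec.ite (hlen 1) (Primrec.const _) <|
      Primrec.ite (hlen 2) (Primrec.const _) <| Primrec.ite (hlen 3) (Primrec.const _) <|
      Primrec.ite (hlen 4) (Primrec.option_some.comp (Code.primrec₂_curry.comp
        (Primrec.const _) (Primrec.encode.comp Primrec.fst))) hmain
  · intro γ n
    match n with
    | 0 => simp [OCode.ofNat, OCode.subst]
    | 1 => simp [OCode.ofNat, OCode.subst]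
    | 2 => simp [OCode.ofNat, OCode.subst]
    | 3 => simp [OCode.ofNat, OCode.subst]
    | 4 => simp [OCode.ofNat, OCode.subst]
    | n + 5 =>
      have hm : n.div2.div2 < n + 5 := by
        simp only [Nat.div2_val]
        omega
      have h1 := lt_of_le_of_lt (Nat.unpair_left_le n.div2.div2) hm
      have h2 := lt_of_le_of_lt (Nat.unpair_right_le n.div2.div2) hm
      simp only [List.length_map, List.length_range, Nat.add_sub_cancel, main, OCode.ofNat_add_five,
        List.getElem?_map, List.getElem?_range hm, List.getElem?_range h1,
        List.getElem?_range h2, Option.map_some, Option.bind_some]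
      cases n.bodd <;> cases n.div2.bodd <;> simp [OCode.subst]

theorem initSeg_take (A : ℕ → ℕ) {m n : ℕ} (h : m ≤ n) : (initSeg A n).take m = initSeg A m := by
  simp [initSeg, ← List.map_take, List.take_range, h]

theorem exists_initSeg_pair {P : ℕ → ℕ → List ℕ → Prop} (A : ℕ → ℕ) :
    (∃ w m, P w m (initSeg A m)) ↔
      ∃ n, P n.unpair.1 n.unpair.2 ((initSeg A n).take n.unpair.2) := by
  constructor
  · rintro ⟨w, m, h⟩
    refine ⟨Nat.pair w m, ?_⟩
    rw [initSeg_take _ (by simpa using Nat.right_le_pair w m)]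
    simpa using h
  · rintro ⟨n, h⟩
    refine ⟨n.unpair.1, n.unpair.2, ?_⟩
    rwa [initSeg_take _ (Nat.unpair_right_le n)] at h

/-- The evaluation relation of oracle machines has a normal form uniform in the oracle. -/
theorem exists_evalo_normal_form : ∃ r : ℕ × ℕ × ℕ → List ℕ → Prop, PrimrecRel r ∧
    ∀ A e x y, y ∈ evalo A (OCode.ofNat e) x ↔ ∃ n, r (e, x, y) (initSeg A n) := by
  refine ⟨fun p γ => Code.evaln γ.length.unpair.1
    ((OCode.ofNat p.1).subst (γ.take γ.length.unpair.2)) p.2.1 = some p.2.2, ?_, ?_⟩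
  · have hl : Primrec fun q : (ℕ × ℕ × ℕ) × List ℕ => q.2.length.unpair :=
      Primrec.unpair.comp (Primrec.list_length.comp Primrec.snd)
    refine PrimrecRel.comp Primrec.eq (Code.primrec_evaln.comp ((Primrec.pair
      (Primrec.fst.comp hl) (primrec_subst_ofNat.comp (Primrec.list_take.comp
        (Primrec.snd.comp hl) Primrec.snd) (Primrec.fst.comp Primrec.fst))).pair
      (Primrec.fst.comp (Primrec.snd.comp Primrec.fst))))
      (Primrec.option_some.comp (Primrec.snd.comp (Primrec.snd.comp Primrec.fst)))
  · intro A e x y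
    simp only [mem_evalo_iff, Code.evaln_complete, initSeg_length]
    rw [exists_comm, exists_initSeg_pair A
      (P := fun w m γ => y ∈ Code.evaln w ((OCode.ofNat e).subst γ) x)]
    rfl

/-! ### Relations semirecursive in an oracle -/

/-- `R` is `Σ⁰₁` relative to `A`, in normal form. -/
def SigmaOneIn (A : ℕ → ℕ) {α : Type*} [Primcodable α] (R : α → Prop) : Prop :=
  ∃ r : α → List ℕ → Prop, PrimrecRel r ∧ ∀ a, R a ↔ ∃ n, r a (initSeg A n)

namespace SigmaOneIn

variable {A : ℕ → ℕ} {α β : Type*} [Primcodable α] [Primcodable β]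

theorem of_iff {R S : α → Prop} (h : SigmaOneIn A R) (H : ∀ a, S a ↔ R a) : SigmaOneIn A S := by
  obtain ⟨r, hr, h⟩ := h
  exact ⟨r, hr, fun a => (H a).trans (h a)⟩

theorem of_primrec {R : α → Prop} (h : PrimrecPred R) : SigmaOneIn A R :=
  ⟨fun a _ => R a, h.comp Primrec.fst, fun _ => by simp⟩

theorem comp {R : β → Prop} (h : SigmaOneIn A R) {f : α → β} (hf : Primrec f) :
    SigmaOneIn A fun a => R (f a) := by
  obtain ⟨r, hr, h⟩ := h
  exact ⟨fun a γ => r (f a) γ, hr.comp (hf.comp Primrec.fst) Primrec.snd, fun a => h (f a)⟩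

theorem exists_nat {R : α → ℕ → Prop} (h : SigmaOneIn A fun p : α × ℕ => R p.1 p.2) :
    SigmaOneIn A fun a => ∃ w, R a w := by
  obtain ⟨r, hr, h⟩ := h
  refine ⟨fun a γ => r (a, γ.length.unpair.1) (γ.take γ.length.unpair.2), ?_, fun a => ?_⟩
  · have hl : Primrec fun q : α × List ℕ => q.2.length.unpair :=
      Primrec.unpair.comp (Primrec.list_length.comp Primrec.snd)
    exact hr.comp (Primrec.pair Primrec.fst (Primrec.fst.comp hl))
      (Primrec.list_take.comp (Primrec.snd.comp hl) Primrec.snd)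
  · simp only [initSeg_length]
    rw [← exists_initSeg_pair A (P := fun w m γ => r (a, w) γ)]
    exact exists_congr fun w => h (a, w)

end SigmaOneIn

theorem primrecRel_exists_lt {α : Type*} [Primcodable α] {R : ℕ → α → Prop} (h : PrimrecRel R) :
    PrimrecRel fun (n : ℕ) a => ∃ i < n, R i a :=
  (h.exists_mem_list.comp (Primrec.list_range.comp Primrec.fst) Primrec.snd).of_eq
    fun p => by simp

theorem primrecRel_forall_lt {α : Type*} [Primcodable α] {R : ℕ → α → Prop} (h : PrimrecRel R) :
    PrimrecRel fun (n : ℕ) a => ∀ i < n, R i a :=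
  (h.forall_mem_list.comp (Primrec.list_range.comp Primrec.fst) Primrec.snd).of_eq
    fun p => by simp

theorem initSeg_mono (A : ℕ → ℕ) {m n : ℕ} (h : m ≤ n) : initSeg A m <+: initSeg A n := by
  rw [← initSeg_take A h]
  exact List.take_prefix _ _

namespace SigmaOneIn

variable {A C : ℕ → ℕ} {α β : Type*} [Primcodable α] [Primcodable β]

theorem exists_mem {R : α → β → Prop} (h : SigmaOneIn A fun p : α × β => R p.1 p.2) :
    SigmaOneIn A fun a => ∃ b, R a b := by
  obtain ⟨r, hr, h⟩ := h
  have : SigmaOneIn A fun p : α × ℕ => ∃ b : β, decode p.2 = some b ∧ R p.1 b := by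
    refine ⟨fun p γ => ∃ b ∈ (decode (α := β) p.2).toList, r (p.1, b) γ, ?_, fun p => ?_⟩
    · have h1 : PrimrecRel fun (l : List β) (q : (α × ℕ) × List ℕ) =>
          ∃ b ∈ l, r (q.1.1, b) q.2 := by
        refine PrimrecRel.exists_mem_list (R := fun b (q : (α × ℕ) × List ℕ) =>
          r (q.1.1, b) q.2) ?_
        exact hr.comp (Primrec.pair (Primrec.fst.comp (Primrec.fst.comp Primrec.snd)) Primrec.fst)
          (Primrec.snd.comp Primrec.snd)
      exact h1.comp (Primrec.optionToList.comp (Primrec.decode.comp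
        (Primrec.snd.comp Primrec.fst))) Primrec.id
    · beta_reduce
      cases decode (α := β) p.2 with
      | none => simp
      | some b => simpa using h (p.1, b)
  refine (exists_nat (R := fun a w => ∃ b : β, decode w = some b ∧ R a b) this).of_iff
    fun a => ⟨fun ⟨b, hb⟩ => ⟨encode b, b, by simp, hb⟩, ?_⟩
  rintro ⟨w, b, -, hb⟩
  exact ⟨b, hb⟩

theorem and {R S : α → Prop} (h : SigmaOneIn A R) (h' : SigmaOneIn A S) :
    SigmaOneIn A fun a => R a ∧ S a := by
  obtain ⟨r, hr, h⟩ := h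
  obtain ⟨s, hs, h'⟩ := h'
  refine ⟨fun a γ => r a (γ.take γ.length.unpair.1) ∧ s a (γ.take γ.length.unpair.2),
    ?_, fun a => ?_⟩
  · have hl : Primrec fun q : α × List ℕ => q.2.length.unpair :=
      Primrec.unpair.comp (Primrec.list_length.comp Primrec.snd)
    exact PrimrecPred.and (hr.comp Primrec.fst (Primrec.list_take.comp (Primrec.fst.comp hl)
      Primrec.snd)) (hs.comp Primrec.fst (Primrec.list_take.comp (Primrec.snd.comp hl)
      Primrec.snd))
  · simp only [initSeg_length, initSeg_take _ (Nat.unpair_left_le _),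
      initSeg_take _ (Nat.unpair_right_le _), h, h']
    constructor
    · rintro ⟨⟨i, hi⟩, j, hj⟩
      exact ⟨Nat.pair i j, by simpa using ⟨hi, hj⟩⟩
    · rintro ⟨n, h1, h2⟩
      exact ⟨⟨_, h1⟩, _, h2⟩

theorem or {R S : α → Prop} (h : SigmaOneIn A R) (h' : SigmaOneIn A S) :
    SigmaOneIn A fun a => R a ∨ S a := by
  obtain ⟨r, hr, h⟩ := h
  obtain ⟨s, hs, h'⟩ := h'
  refine ⟨fun a γ => r a γ ∨ s a γ, PrimrecPred.or hr hs, fun a => ?_⟩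
  simp only [h, h', exists_or]

/-- The witness of a `Σ⁰₁` relation may be taken monotone in the oracle string. -/
theorem exists_monotone {R : α → Prop} (h : SigmaOneIn A R) :
    ∃ r : α → List ℕ → Prop, PrimrecRel r ∧ (∀ a γ δ, γ <+: δ → r a γ → r a δ) ∧
      ∀ a, R a ↔ ∃ n, r a (initSeg A n) := by
  obtain ⟨r, hr, h⟩ := h
  refine ⟨fun a γ => ∃ m < γ.length + 1, r a (γ.take m), ?_, ?_, fun a => ?_⟩
  · have : PrimrecRel fun (n : ℕ) (q : α × List ℕ) => ∃ m < n, r q.1 (q.2.take m) := by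
      refine primrecRel_exists_lt (R := fun m (q : α × List ℕ) => r q.1 (q.2.take m)) ?_
      exact hr.comp (Primrec.fst.comp Primrec.snd)
        (Primrec.list_take.comp Primrec.fst (Primrec.snd.comp Primrec.snd))
    exact this.comp (Primrec.succ.comp (Primrec.list_length.comp Primrec.snd)) Primrec.id
  · rintro a γ _ ⟨δ, rfl⟩ ⟨m, hm, h⟩
    refine ⟨m, by simp; omega, ?_⟩
    rwa [List.take_append_of_le_length (by omega)]
  · rw [h]
    constructor
    · rintro ⟨n, hn⟩
      exact ⟨n, n, by simp, by rwa [initSeg_take _ le_rfl]⟩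
    · rintro ⟨n, m, hm, h⟩
      rw [initSeg_length] at hm
      exact ⟨m, by rwa [initSeg_take _ (by omega)] at h⟩

theorem oracle (A : ℕ → ℕ) : SigmaOneIn A fun p : ℕ × ℕ => A p.1 = p.2 := by
  refine ⟨fun p γ => γ[p.1]? = some p.2, ?_, fun p => ?_⟩
  · exact Primrec.eq.comp (Primrec.list_getElem?.comp Primrec.snd (Primrec.fst.comp Primrec.fst))
      (Primrec.option_some.comp (Primrec.snd.comp Primrec.fst))
  · simp only [initSeg_getElem?]
    constructor
    · intro h
      exact ⟨p.1 + 1, by simp [h]⟩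
    · rintro ⟨n, hn⟩
      split_ifs at hn
      simpa using hn

theorem eq_initSeg_length (h : SigmaOneIn C fun p : ℕ × ℕ => A p.1 = p.2) :
    SigmaOneIn C fun τ : List ℕ => τ = initSeg A τ.length := by
  obtain ⟨r, hr, hmono, h⟩ := h.exists_monotone
  refine ⟨fun τ γ => ∀ i < τ.length, r (i, τ.getD i 0) γ, ?_, fun τ => ?_⟩
  · have : PrimrecRel fun (n : ℕ) (q : List ℕ × List ℕ) =>
        ∀ i < n, r (i, q.1.getD i 0) q.2 := by
      refine primrecRel_forall_lt (R := fun i (q : List ℕ × List ℕ) =>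
        r (i, q.1.getD i 0) q.2) ?_
      exact hr.comp (Primrec.pair Primrec.fst ((Primrec.list_getD 0).comp
        (Primrec.fst.comp Primrec.snd) Primrec.fst)) (Primrec.snd.comp Primrec.snd)
    exact this.comp (Primrec.list_length.comp Primrec.fst) Primrec.id
  · have key : τ = initSeg A τ.length ↔ ∀ i < τ.length, A i = τ.getD i 0 := by
      constructor
      · intro h i hi
        rw [h]
        simp [initSeg, List.getD, hi]
      · intro h
        refine List.ext_getElem (by simp) fun i h1 h2 => ?_
        have := h i h1
        rw [List.getD_eq_getElem _ _ h1] at this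
        simp [initSeg, this]
    refine key.trans ?_
    constructor
    · intro H
      have : ∀ l ≤ τ.length, ∃ n, ∀ i < l, r (i, τ.getD i 0) (initSeg C n) := by
        intro l
        induction l with
        | zero => simp
        | succ l ih =>
          intro hl
          obtain ⟨n, hn⟩ := ih (by omega)
          obtain ⟨m, hm⟩ := (h (l, τ.getD l 0)).1 (H l (by omega))
          refine ⟨max n m, fun i hi => ?_⟩
          rcases Nat.lt_succ_iff_lt_or_eq.1 hi with hi | rfl
          · exact hmono _ _ _ (initSeg_mono C (le_max_left _ _)) (hn i hi)
          · exact hmono _ _ _ (initSeg_mono C (le_max_right _ _)) hm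
      exact this _ le_rfl
    · rintro ⟨n, hn⟩ i hi
      exact (h (i, τ.getD i 0)).2 ⟨n, hn i hi⟩

theorem trans {R : α → Prop} (h : SigmaOneIn A R)
    (hA : SigmaOneIn C fun p : ℕ × ℕ => A p.1 = p.2) : SigmaOneIn C R := by
  obtain ⟨r, hr, h⟩ := h
  have h1 : SigmaOneIn C fun p : α × List ℕ => r p.1 p.2 ∧ p.2 = initSeg A p.2.length :=
    (of_primrec hr).and ((eq_initSeg_length hA).comp Primrec.snd)
  refine (exists_mem (R := fun a γ => r a γ ∧ γ = initSeg A γ.length) h1).of_iff fun a => ?_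
  rw [h]
  constructor
  · rintro ⟨n, hn⟩
    exact ⟨_, hn, by simp⟩
  · rintro ⟨γ, h1, h2⟩
    exact ⟨γ.length, h2 ▸ h1⟩

end SigmaOneIn

/-- Partial recursive codes as oracle codes. -/
def OCode.ofCode : Code → OCode
  | .zero => zero
  | .succ => succ
  | .left => left
  | .right => right
  | .pair c d => pair (ofCode c) (ofCode d)
  | .comp c d => comp (ofCode c) (ofCode d)
  | .prec c d => prec (ofCode c) (ofCode d)
  | .rfind' c => rfind' (ofCode c)

theorem evalo_ofCode (A : ℕ → ℕ) (c : Code) : evalo A (OCode.ofCode c) = c.eval := by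
  induction c with
  | zero => rfl
  | succ => rfl
  | left => rfl
  | right => rfl
  | pair c d hc hd => funext n; simp [OCode.ofCode, evalo, Code.eval, hc, hd]
  | comp c d hc hd => funext n; simp [OCode.ofCode, evalo, Code.eval, hc, hd]
  | prec c d hc hd => simp [OCode.ofCode, evalo, Code.eval, hc, hd]; rfl
  | rfind' c hc => simp only [OCode.ofCode, evalo, Code.eval, hc]; rfl

theorem exists_evalo_primrec {f : ℕ → ℕ} (hf : Primrec f) :
    ∃ c, ∀ A n, evalo A c n = Part.some (f n) := by
  obtain ⟨c, hc⟩ := Code.exists_code.1 (Partrec.nat_iff.1 hf.to_comp)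
  exact ⟨OCode.ofCode c, fun A n => by rw [evalo_ofCode, hc]; rfl⟩

theorem some_bind_eq (a : ℕ) (f : ℕ →. ℕ) : (Part.some a >>= f) = f a := Part.bind_some _ _

theorem exists_evalo_initSeg :
    ∃ c, ∀ A n, evalo A c n = Part.some (encode (initSeg A n)) := by
  obtain ⟨s, hs⟩ := exists_evalo_primrec (f := fun p : ℕ =>
      encode (((decode p.unpair.1 : Option (List ℕ)).getD []) ++ [p.unpair.2])) <|
    Primrec.encode.comp (Primrec.list_append.comp (Primrec.option_getD.comp
      (Primrec.decode.comp (Primrec.fst.comp Primrec.unpair)) (Primrec.const _))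
      (Primrec.list_cons.comp (Primrec.snd.comp Primrec.unpair) (Primrec.const _)))
  obtain ⟨z, hz⟩ := exists_evalo_primrec (f := fun _ => encode ([] : List ℕ)) (Primrec.const _)
  obtain ⟨q, hq⟩ := exists_evalo_primrec (f := fun n => Nat.pair 0 n)
    (Primrec₂.natPair.comp (Primrec.const 0) Primrec.id)
  refine ⟨.comp (.prec z (.comp s (.pair (.comp .right .right)
    (.comp .oracle (.comp .left .right))))) q, fun A n => ?_⟩
  have key : ∀ m, evalo A (.prec z (.comp s (.pair (.comp .right .right)
      (.comp .oracle (.comp .left .right))))) (Nat.pair 0 m) =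
        Part.some (encode (initSeg A m)) := by
    intro m
    induction m with
    | zero => simp [evalo, hz, initSeg]
    | succ m ih =>
      simp only [evalo, Nat.unpaired, Nat.unpair_pair] at ih ⊢
      rw [ih]
      simp [some_bind_eq, hs, initSeg, List.range_succ, Seq.seq]
  change evalo A q n >>= _ = _
  rw [hq]
  exact (some_bind_eq _ _).trans (key n)

/-- Unbounded search over initial segments of the oracle is carried out by an oracle machine. -/
theorem exists_evalo_search {r : ℕ → List ℕ → Prop} (hr : PrimrecRel r) :
    ∃ c, ∀ A a n, n ∈ evalo A c a ↔ r a (initSeg A n) ∧ ∀ m < n, ¬ r a (initSeg A m) := by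
  obtain ⟨s, hs⟩ := exists_evalo_initSeg
  obtain ⟨t, ht⟩ := exists_evalo_primrec (f := fun p : ℕ =>
      if r p.unpair.1 ((decode p.unpair.2 : Option (List ℕ)).getD []) then 0 else 1) <|
    Primrec.ite (hr.comp (Primrec.fst.comp Primrec.unpair) (Primrec.option_getD.comp
      (Primrec.decode.comp (Primrec.snd.comp Primrec.unpair)) (Primrec.const _)))
      (Primrec.const _) (Primrec.const _)
  obtain ⟨q, hq⟩ := exists_evalo_primrec (f := fun n => Nat.pair n 0)
    (Primrec₂.natPair.comp Primrec.id (Primrec.const 0))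
  let d := OCode.comp t (.pair .left (.comp s .right))
  have hd : ∀ A a n, evalo A d (Nat.pair a n) =
      Part.some (if r a (initSeg A n) then 0 else 1) := by
    intro A a n
    simp [some_bind_eq, d, evalo, hs, ht, Seq.seq]
  refine ⟨.comp (.rfind' d) q, fun A a n => ?_⟩
  have : evalo A (.comp (.rfind' d) q) a = evalo A (.rfind' d) (Nat.pair a 0) := by
    change evalo A q a >>= _ = _
    rw [hq]
    exact some_bind_eq _ _
  rw [this]
  simp only [evalo, Nat.unpaired, Nat.unpair_pair]
  rw [mem_rfind_zero_iff]
  simp only [Nat.add_zero, hd]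
  constructor
  · rintro ⟨k, h1, h2, rfl⟩
    refine ⟨by by_contra h; simp [h] at h1, fun m hm h => ?_⟩
    obtain ⟨v, hv, hv'⟩ := h2 m hm
    simp [h] at hv
    exact hv' hv
  · rintro ⟨h1, h2⟩
    exact ⟨n, by simp [h1], fun i hi => ⟨1, by simp [h2 i hi], one_ne_zero⟩, rfl⟩

theorem exists_ofNat_eq (c : OCode) : ∃ e, OCode.ofNat e = c := by
  have key : ∀ (b b' : Bool) (k : ℕ), ∃ n : ℕ, n.bodd = b ∧ n.div2.bodd = b' ∧ n.div2.div2 = k :=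
    fun b b' k => ⟨Nat.bit b (Nat.bit b' k), by simp⟩
  induction c with
  | zero => exact ⟨0, by simp [OCode.ofNat]⟩
  | succ => exact ⟨1, by simp [OCode.ofNat]⟩
  | left => exact ⟨2, by simp [OCode.ofNat]⟩
  | right => exact ⟨3, by simp [OCode.ofNat]⟩
  | oracle => exact ⟨4, by simp [OCode.ofNat]⟩
  | pair c d hc hd =>
    obtain ⟨i, rfl⟩ := hc
    obtain ⟨j, rfl⟩ := hd
    obtain ⟨n, h1, h2, h3⟩ := key false false (Nat.pair i j)
    exact ⟨n + 5, by simp [OCode.ofNat_add_five, h1, h2, h3]⟩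
  | comp c d hc hd =>
    obtain ⟨i, rfl⟩ := hc
    obtain ⟨j, rfl⟩ := hd
    obtain ⟨n, h1, h2, h3⟩ := key false true (Nat.pair i j)
    exact ⟨n + 5, by simp [OCode.ofNat_add_five, h1, h2, h3]⟩
  | prec c d hc hd =>
    obtain ⟨i, rfl⟩ := hc
    obtain ⟨j, rfl⟩ := hd
    obtain ⟨n, h1, h2, h3⟩ := key true false (Nat.pair i j)
    exact ⟨n + 5, by simp [OCode.ofNat_add_five, h1, h2, h3]⟩
  | rfind' c hc =>
    obtain ⟨i, rfl⟩ := hc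
    obtain ⟨n, h1, h2, h3⟩ := key true true i
    exact ⟨n + 5, by simp [OCode.ofNat_add_five, h1, h2, h3]⟩

theorem ofNat_comp (i j : ℕ) : OCode.ofNat (4 * Nat.pair i j + 7) =
    .comp (OCode.ofNat i) (OCode.ofNat j) := by
  have h1 : (4 * Nat.pair i j + 2).bodd = false := by simp
  have h2 : (4 * Nat.pair i j + 2).div2 = 2 * Nat.pair i j + 1 := by
    rw [Nat.div2_val]; omega
  have h3 : (2 * Nat.pair i j + 1).bodd = true := by simp
  have h4 : (2 * Nat.pair i j + 1).div2 = Nat.pair i j := by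
    rw [Nat.div2_val]; omega
  change OCode.ofNat ((4 * Nat.pair i j + 2) + 5) = _
  rw [OCode.ofNat]
  simp only [h1, h2, h3, h4, Nat.unpair_pair]

/-- Indices of composition with a constant function. -/
theorem exists_index_comp_const (c : OCode) : ∃ g : ℕ → ℕ, Primrec g ∧
    ∀ A a x, evalo A (OCode.ofNat (g a)) x = evalo A c a := by
  obtain ⟨i, rfl⟩ := exists_ofNat_eq c
  have hcomp : Primrec₂ fun i j => 4 * Nat.pair i j + 7 :=
    Primrec.nat_add.comp (Primrec.nat_mul.comp (Primrec.const 4) Primrec₂.natPair)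
      (Primrec.const 7)
  let k : ℕ → ℕ := fun a => Nat.rec 0 (fun _ e => 4 * Nat.pair 1 e + 7) a
  have hk : Primrec k := Primrec.nat_rec₁ 0 (hcomp.comp (Primrec.const 1) Primrec.snd)
  have hk' : ∀ A a x, evalo A (OCode.ofNat (k a)) x = Part.some a := by
    intro A a x
    induction a with
    | zero => simp [k, OCode.ofNat, evalo]; rfl
    | succ a ih =>
      change evalo A (OCode.ofNat (4 * Nat.pair 1 (k a) + 7)) x = _
      rw [ofNat_comp]
      change evalo A (OCode.ofNat (k a)) x >>= _ = _
      rw [ih]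
      refine (some_bind_eq _ _).trans ?_
      simp [OCode.ofNat, evalo]
  refine ⟨fun a => 4 * Nat.pair i (k a) + 7, hcomp.comp (Primrec.const i) hk, fun A a x => ?_⟩
  rw [ofNat_comp]
  change evalo A (OCode.ofNat (k a)) x >>= _ = _
  rw [hk']
  exact some_bind_eq _ _

theorem tredIn_iff {X A : ℕ → ℕ} :
    TRedIn X A ↔ SigmaOneIn A fun p : ℕ × ℕ => X p.1 = p.2 := by
  constructor
  · rintro ⟨c, hc⟩
    obtain ⟨e, rfl⟩ := exists_ofNat_eq c
    obtain ⟨r, hr, h⟩ := exists_evalo_normal_form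
    refine ⟨fun p γ => r (e, p.1, p.2) γ, hr.comp (Primrec.pair (Primrec.const e) Primrec.fst)
      Primrec.snd, fun p => ?_⟩
    rw [← h, hc]
    simp [eq_comm]
  · rintro ⟨r, hr, h⟩
    let s : ℕ → List ℕ → Prop := fun a γ =>
      r (a, γ.length.unpair.1) (γ.take γ.length.unpair.2)
    have hs : PrimrecRel s := by
      have hl : Primrec fun q : ℕ × List ℕ => q.2.length.unpair :=
        Primrec.unpair.comp (Primrec.list_length.comp Primrec.snd)
      exact hr.comp (Primrec.pair Primrec.fst (Primrec.fst.comp hl))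
        (Primrec.list_take.comp (Primrec.snd.comp hl) Primrec.snd)
    obtain ⟨c, hc⟩ := exists_evalo_search hs
    refine ⟨.comp .left c, fun a => ?_⟩
    have hex : ∃ n, s a (initSeg A n) := by
      obtain ⟨m, hm⟩ := (h (a, X a)).1 rfl
      refine ⟨Nat.pair (X a) m, ?_⟩
      simp only [s, initSeg_length, initSeg_take _ (Nat.unpair_right_le _)]
      simpa using hm
    obtain ⟨k, h1, h2⟩ : ∃ k, k ∈ evalo A c a ∧ s a (initSeg A k) :=
      ⟨Nat.find hex, (hc A a _).2 ⟨Nat.find_spec hex, fun m hm => Nat.find_min hex hm⟩,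
        Nat.find_spec hex⟩
    simp only [s, initSeg_length, initSeg_take _ (Nat.unpair_right_le _)] at h2
    have h3 : X a = k.unpair.1 := (h (a, _)).2 ⟨_, h2⟩
    change evalo A c a >>= _ = _
    rw [Part.eq_some_iff.2 h1, some_bind_eq]
    exact congrArg Part.some h3.symm

theorem TRedIn.refl (A : ℕ → ℕ) : TRedIn A A := tredIn_iff.2 (SigmaOneIn.oracle A)

theorem TRedIn.trans {X Y Z : ℕ → ℕ} (h : TRedIn X Y) (h' : TRedIn Y Z) : TRedIn X Z :=
  tredIn_iff.2 ((tredIn_iff.1 h).trans (tredIn_iff.1 h'))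

theorem SigmaOneIn.mono {A C : ℕ → ℕ} {α : Type*} [Primcodable α] {R : α → Prop}
    (h : SigmaOneIn A R) (h' : TRedIn A C) : SigmaOneIn C R := h.trans (tredIn_iff.1 h')

/-- The halting problem is `Σ⁰₁` uniformly in the oracle, by a monotone predicate. -/
theorem exists_halting_predicate : ∃ H : ℕ → List ℕ → Prop, PrimrecRel H ∧
    (∀ e γ δ, γ <+: δ → H e γ → H e δ) ∧
    ∀ A e, (evalo A (OCode.ofNat e) e).Dom ↔ ∃ n, H e (initSeg A n) := by
  obtain ⟨r, hr, h⟩ := exists_evalo_normal_form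
  refine ⟨fun e γ => ∃ m < γ.length + 1, r (e, e, m.unpair.1) (γ.take m.unpair.2), ?_, ?_, ?_⟩
  · have : PrimrecRel fun (n : ℕ) (q : ℕ × List ℕ) =>
        ∃ m < n, r (q.1, q.1, m.unpair.1) (q.2.take m.unpair.2) := by
      refine primrecRel_exists_lt (R := fun m (q : ℕ × List ℕ) =>
        r (q.1, q.1, m.unpair.1) (q.2.take m.unpair.2)) ?_
      have h1 : Primrec fun p : ℕ × ℕ × List ℕ => p.2.1 := Primrec.fst.comp Primrec.snd
      have h2 : Primrec fun p : ℕ × ℕ × List ℕ => p.1.unpair := Primrec.unpair.comp Primrec.fst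
      exact hr.comp (h1.pair (h1.pair (Primrec.fst.comp h2)))
        (Primrec.list_take.comp (Primrec.snd.comp h2) (Primrec.snd.comp Primrec.snd))
    exact this.comp (Primrec.succ.comp (Primrec.list_length.comp Primrec.snd)) Primrec.id
  · rintro e γ _ ⟨δ, rfl⟩ ⟨m, hm, h⟩
    refine ⟨m, by simp; omega, ?_⟩
    rwa [List.take_append_of_le_length ((Nat.unpair_right_le m).trans (by omega))]
  · intro A e
    simp only [Part.dom_iff_mem, h]
    constructor
    · rintro ⟨y, n, hn⟩
      refine ⟨Nat.pair y n, Nat.pair y n, by simp, ?_⟩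
      rw [initSeg_take _ (Nat.unpair_right_le _)]
      simpa using hn
    · rintro ⟨n, m, hm, h⟩
      rw [initSeg_length] at hm
      rw [initSeg_take _ ((Nat.unpair_right_le _).trans (by omega))] at h
      exact ⟨_, _, h⟩

/-- A fixed monotone predicate deciding halting from finite oracle information. -/
noncomputable def haltsBy : ℕ → List ℕ → Prop := Classical.choose exists_halting_predicate

theorem primrecRel_haltsBy : PrimrecRel haltsBy :=
  (Classical.choose_spec exists_halting_predicate).1

theorem haltsBy_mono {e : ℕ} {γ δ : List ℕ} (h : γ <+: δ) (H : haltsBy e γ) : haltsBy e δ :=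
  (Classical.choose_spec exists_halting_predicate).2.1 e γ δ h H

theorem dom_iff_haltsBy (A : ℕ → ℕ) (e : ℕ) :
    (evalo A (OCode.ofNat e) e).Dom ↔ ∃ n, haltsBy e (initSeg A n) :=
  (Classical.choose_spec exists_halting_predicate).2.2 A e

theorem sigmaOneIn_dom (A : ℕ → ℕ) :
    SigmaOneIn A fun e : ℕ => (evalo A (OCode.ofNat e) e).Dom :=
  ⟨haltsBy, primrecRel_haltsBy, dom_iff_haltsBy A⟩

theorem SigmaOneIn.exists_code {A : ℕ → ℕ} {R : ℕ → Prop} (h : SigmaOneIn A R) :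
    ∃ c, ∀ a, (evalo A c a).Dom ↔ R a := by
  obtain ⟨r, hr, h⟩ := h
  obtain ⟨c, hc⟩ := exists_evalo_search hr
  refine ⟨c, fun a => ?_⟩
  rw [h, Part.dom_iff_mem]
  constructor
  · rintro ⟨n, hn⟩
    exact ⟨n, ((hc A a n).1 hn).1⟩
  · intro hex
    exact ⟨Nat.find hex, (hc A a _).2 ⟨Nat.find_spec hex, fun m hm => Nat.find_min hex hm⟩⟩

theorem SigmaOneIn.exists_jump_reduction {A : ℕ → ℕ} {α : Type*} [Primcodable α] {R : α → Prop}
    (h : SigmaOneIn A R) : ∃ g : α → ℕ, Primrec g ∧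
      ∀ a, (R a → jump A (g a) = 1) ∧ (¬ R a → jump A (g a) = 0) := by
  have h1 : SigmaOneIn A fun n : ℕ => ∃ a : α, encode a = n ∧ R a := by
    refine exists_mem (R := fun (n : ℕ) (a : α) => encode a = n ∧ R a) (.and (of_primrec ?_)
      (h.comp Primrec.snd))
    exact Primrec.eq.comp (Primrec.encode.comp Primrec.snd) Primrec.fst
  obtain ⟨c, hc⟩ := h1.exists_code
  obtain ⟨g, hg, hg'⟩ := exists_index_comp_const c
  refine ⟨fun a => g (encode a), hg.comp Primrec.encode, fun a => ?_⟩
  have : (evalo A (OCode.ofNat (g (encode a))) (g (encode a))).Dom ↔ R a := by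
    rw [hg', hc]
    simp
  exact ⟨fun h => by simp [jump, this, h], fun h => by simp [jump, this, h]⟩

theorem SigmaOneIn.jump {A : ℕ → ℕ} {α : Type*} [Primcodable α] {R : α → Prop}
    (h : SigmaOneIn A R) : SigmaOneIn (jump A) R := by
  obtain ⟨g, hg, h⟩ := h.exists_jump_reduction
  refine ((oracle (Harrington.jump A)).comp (hg.pair (Primrec.const 1))).of_iff fun a => ?_
  by_cases ha : R a
  · simp [ha, (h a).1 ha]
  · simp [ha, (h a).2 ha]

theorem SigmaOneIn.not_jump {A : ℕ → ℕ} {α : Type*} [Primcodable α] {R : α → Prop}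
    (h : SigmaOneIn A R) : SigmaOneIn (Harrington.jump A) fun a => ¬ R a := by
  obtain ⟨g, hg, h⟩ := h.exists_jump_reduction
  refine ((oracle (Harrington.jump A)).comp (hg.pair (Primrec.const 0))).of_iff fun a => ?_
  by_cases ha : R a
  · simp [ha, (h a).1 ha]
  · simp [ha, (h a).2 ha]

theorem TRedIn.jump_of_sigmaOneIn {A C : ℕ → ℕ}
    (h : SigmaOneIn C fun e : ℕ => (evalo A (OCode.ofNat e) e).Dom)
    (h' : SigmaOneIn C fun e : ℕ => ¬ (evalo A (OCode.ofNat e) e).Dom) :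
    TRedIn (jump A) C := by
  refine tredIn_iff.2 ?_
  refine SigmaOneIn.of_iff (R := fun p : ℕ × ℕ => (evalo A (OCode.ofNat p.1) p.1).Dom ∧ p.2 = 1 ∨
    ¬ (evalo A (OCode.ofNat p.1) p.1).Dom ∧ p.2 = 0) ?_ fun p => ?_
  · exact .or (.and (h.comp Primrec.fst) (.of_primrec (Primrec.eq.comp Primrec.snd
      (Primrec.const 1)))) (.and (h'.comp Primrec.fst) (.of_primrec (Primrec.eq.comp Primrec.snd
      (Primrec.const 0))))
  · by_cases hp : (evalo A (OCode.ofNat p.1) p.1).Dom <;> simp [jump, hp, eq_comm]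

theorem TRedIn.jump {A C : ℕ → ℕ} (h : TRedIn A C) : TRedIn (jump A) (jump C) :=
  jump_of_sigmaOneIn ((sigmaOneIn_dom A).mono h).jump ((sigmaOneIn_dom A).mono h).not_jump

theorem TRedIn.self_jump (A : ℕ → ℕ) : TRedIn A (Harrington.jump A) :=
  tredIn_iff.2 (SigmaOneIn.oracle A).jump

theorem not_tredIn_jump (A : ℕ → ℕ) : ¬ TRedIn (jump A) A := by
  intro h
  obtain ⟨c, hc⟩ := ((sigmaOneIn_dom A).not_jump.mono h).exists_code
  obtain ⟨e, rfl⟩ := exists_ofNat_eq c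
  have := hc e
  tauto

theorem TRedIn.jumpIter {A C : ℕ → ℕ} (h : TRedIn A C) (n : ℕ) :
    TRedIn (jumpIter A n) (jumpIter C n) := by
  induction n with
  | zero => exact h
  | succ n ih => exact ih.jump

theorem jumpIter_jump (A : ℕ → ℕ) (n : ℕ) : jumpIter (jump A) n = jumpIter A (n + 1) := by
  induction n with
  | zero => rfl
  | succ n ih => rw [jumpIter, ih]; rfl

theorem TRedIn.self_jumpIter (A : ℕ → ℕ) (n : ℕ) : TRedIn A (Harrington.jumpIter A n) := by
  induction n with
  | zero => exact .refl A
  | succ n ih => exact ih.trans (.self_jump _)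

/-! ### Joins -/

theorem oplus_even (A B : ℕ → ℕ) (n : ℕ) : oplus A B (2 * n) = A n := by simp [oplus]

theorem oplus_odd (A B : ℕ → ℕ) (n : ℕ) : oplus A B (2 * n + 1) = B n := by
  simp [oplus, Nat.add_mod, show (2 * n + 1) / 2 = n by omega]

theorem tredIn_oplus_left (A B : ℕ → ℕ) : TRedIn A (oplus A B) := by
  refine tredIn_iff.2 (((SigmaOneIn.oracle (oplus A B)).comp ((Primrec.nat_mul.comp
    (Primrec.const 2) Primrec.fst).pair Primrec.snd)).of_iff fun p => ?_)
  rw [oplus_even]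

theorem tredIn_oplus_right (A B : ℕ → ℕ) : TRedIn B (oplus A B) := by
  refine tredIn_iff.2 (((SigmaOneIn.oracle (oplus A B)).comp ((Primrec.succ.comp
    (Primrec.nat_mul.comp (Primrec.const 2) Primrec.fst)).pair Primrec.snd)).of_iff fun p => ?_)
  rw [Nat.succ_eq_add_one, oplus_odd]

theorem TRedIn.oplus {A B C : ℕ → ℕ} (hA : TRedIn A C) (hB : TRedIn B C) :
    TRedIn (oplus A B) C := by
  have hd : Primrec fun p : ℕ × ℕ => (p.1 / 2, p.2) :=
    (Primrec.nat_div.comp Primrec.fst (Primrec.const 2)).pair Primrec.snd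
  have hm : PrimrecPred fun p : ℕ × ℕ => p.1 % 2 = 0 :=
    Primrec.eq.comp (Primrec.nat_mod.comp Primrec.fst (Primrec.const 2)) (Primrec.const 0)
  refine tredIn_iff.2 (((SigmaOneIn.and (.of_primrec hm) ((tredIn_iff.1 hA).comp hd)).or
    (.and (.of_primrec hm.not) ((tredIn_iff.1 hB).comp hd))).of_iff fun p => ?_)
  by_cases h : p.1 % 2 = 0
  · simp [Harrington.oplus, h]
  · simp [Harrington.oplus, Nat.mod_two_ne_zero.1 h]

theorem SigmaOneIn.of_primrec_initSeg {A : ℕ → ℕ} {α : Type*} [Primcodable α]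
    {r : α → List ℕ → Prop} (hr : PrimrecRel r) :
    SigmaOneIn A fun p : α × ℕ => r p.1 (initSeg A p.2) := by
  refine ⟨fun p γ => γ.length = p.2 ∧ r p.1 γ, PrimrecPred.and (Primrec.eq.comp
    (Primrec.list_length.comp Primrec.snd) (Primrec.snd.comp Primrec.fst))
    (hr.comp (Primrec.fst.comp Primrec.fst) Primrec.snd), fun p => ?_⟩
  simp

/-- `{Z}` is a `Π⁰₁` class relative to `B`, presented by a `Σ⁰₁` set of forbidden strings. -/
def IsPi01Singleton (B Z : ℕ → ℕ) : Prop :=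
  ∃ K : List ℕ → Prop, SigmaOneIn B K ∧ ∀ X, (∀ n, ¬ K (initSeg X n)) ↔ X = Z

theorem primrec_initSeg_zeroF : Primrec (initSeg zeroF) :=
  Primrec.list_map Primrec.list_range (Primrec.const 0).to₂

theorem IsPi01Singleton.isPi01 {Z : ℕ → ℕ} (h : IsPi01Singleton zeroF Z) : IsPi01 {Z} := by
  obtain ⟨K, hK, hZ⟩ := h
  obtain ⟨r, hr, hmono, h⟩ := hK.exists_monotone
  let T : Set Str := {σ | ∀ k < σ.length + 1, ¬ r (σ.take k) (initSeg zeroF σ.length)}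
  refine ⟨T, ?_, ?_, ?_⟩
  · rintro σ _ ⟨ρ, rfl⟩ hT k hk hr'
    refine hT k (by simp; omega) ?_
    rw [List.take_append_of_le_length (by omega)]
    exact hmono _ _ _ (initSeg_mono _ (by simp)) hr'
  · have hT : PrimrecPred fun σ : Str => σ ∈ T := by
      have : PrimrecRel fun (n : ℕ) (σ : List ℕ) =>
          ∀ k < n, ¬ r (σ.take k) (initSeg zeroF σ.length) := by
        refine primrecRel_forall_lt (R := fun k (σ : List ℕ) =>
          ¬ r (σ.take k) (initSeg zeroF σ.length)) (PrimrecPred.not ?_)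
        exact hr.comp (Primrec.list_take.comp Primrec.fst Primrec.snd)
          (primrec_initSeg_zeroF.comp (Primrec.list_length.comp Primrec.snd))
      exact this.comp (Primrec.succ.comp Primrec.list_length) Primrec.id
    have hchi : Primrec fun e : ℕ => chi T ((decode e : Option Str).getD []) := by
      have h1 : Primrec (chi T) :=
        (Primrec.ite hT (Primrec.const 1) (Primrec.const 0)).of_eq fun σ => by
          simp only [chi]
          congr
      exact h1.comp (Primrec.option_getD.comp Primrec.decode (Primrec.const _))
    obtain ⟨c, hc⟩ := exists_evalo_primrec hchi
    exact ⟨c, fun σ => by simp [hc]⟩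
  · ext X
    rw [Set.mem_singleton_iff, ← hZ]
    constructor
    · rintro hX n k hk hr'
      rw [initSeg_length] at hk hr'
      rw [initSeg_take _ (by omega)] at hr'
      exact hX k ((h _).2 ⟨_, hr'⟩)
    · intro hX n hK
      obtain ⟨m, hm⟩ := (h _).1 hK
      have := hX (max n m) n (by simp)
      rw [initSeg_length, initSeg_take _ (le_max_left _ _)] at this
      exact this (hmono _ _ _ (initSeg_mono _ (le_max_right _ _)) hm)

/-- The first stage at which halting is confirmed, shifted by one, or `0` if there is none. -/
noncomputable def haltTime (B : ℕ → ℕ) (e : ℕ) : ℕ :=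
  if h : ∃ n, haltsBy e (initSeg B n) then Nat.find h + 1 else 0

theorem haltTime_eq_zero_iff {B : ℕ → ℕ} {e : ℕ} :
    haltTime B e = 0 ↔ ∀ n, ¬ haltsBy e (initSeg B n) := by
  by_cases h : ∃ n, haltsBy e (initSeg B n)
  · simp [haltTime, h]
  · simp only [haltTime, h, dite_false, true_iff]
    exact not_exists.1 h

theorem haltTime_eq_succ_iff {B : ℕ → ℕ} {e k : ℕ} : haltTime B e = k + 1 ↔
    haltsBy e (initSeg B k) ∧ ∀ m < k, ¬ haltsBy e (initSeg B m) := by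
  by_cases h : ∃ n, haltsBy e (initSeg B n)
  · simp only [haltTime, h, dite_true, Nat.add_right_cancel_iff, Nat.find_eq_iff]
  · simp only [haltTime, h, dite_false]
    push Not at h
    simp [h]

theorem isPi01Singleton_haltTime (B : ℕ → ℕ) : IsPi01Singleton B (haltTime B) := by
  let s : (List ℕ × ℕ × ℕ) → List ℕ → Prop := fun p γ => p.1[p.2.1]? = some p.2.2 ∧
    ((p.2.2 = 0 ∨ γ.length + 1 < p.2.2) ∧ haltsBy p.2.1 γ ∨
      p.2.2 = γ.length + 1 ∧ ¬ haltsBy p.2.1 γ)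
  have hs : PrimrecRel s := by
    have he : Primrec fun q : (List ℕ × ℕ × ℕ) × List ℕ => q.1.2.1 :=
      Primrec.fst.comp (Primrec.snd.comp Primrec.fst)
    have hv : Primrec fun q : (List ℕ × ℕ × ℕ) × List ℕ => q.1.2.2 :=
      Primrec.snd.comp (Primrec.snd.comp Primrec.fst)
    have hl : Primrec fun q : (List ℕ × ℕ × ℕ) × List ℕ => q.2.length + 1 :=
      Primrec.succ.comp (Primrec.list_length.comp Primrec.snd)
    have hh : PrimrecPred fun q : (List ℕ × ℕ × ℕ) × List ℕ => haltsBy q.1.2.1 q.2 :=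
      primrecRel_haltsBy.comp he Primrec.snd
    exact PrimrecPred.and (Primrec.eq.comp (Primrec.list_getElem?.comp
      (Primrec.fst.comp Primrec.fst) he) (Primrec.option_some.comp hv)) (PrimrecPred.or
      (PrimrecPred.and (PrimrecPred.or (Primrec.eq.comp hv (Primrec.const 0))
        (Primrec.nat_lt.comp hl hv)) hh)
      (PrimrecPred.and (Primrec.eq.comp hv hl) hh.not))
  refine ⟨fun τ => ∃ q : ℕ × ℕ, ∃ m, s (τ, q) (initSeg B m), ?_, fun X => ?_⟩
  · refine SigmaOneIn.exists_mem (R := fun τ (q : ℕ × ℕ) => ∃ m, s (τ, q) (initSeg B m)) ?_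
    exact ⟨s, hs, fun _ => Iff.rfl⟩
  · constructor
    · intro hX
      have key : ∀ e m, ¬ ((X e = 0 ∨ m + 1 < X e) ∧ haltsBy e (initSeg B m) ∨
          X e = m + 1 ∧ ¬ haltsBy e (initSeg B m)) := by
        intro e m h
        refine hX (e + 1) ⟨(e, X e), m, ?_, ?_⟩
        · exact (initSeg_getElem? X (e + 1) e).trans (if_pos (Nat.lt_succ_self e))
        · simpa using h
      funext e
      cases hv : X e with
      | zero =>
        refine (haltTime_eq_zero_iff.2 fun m hm => key e m (.inl ⟨.inl hv, hm⟩)).symm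
      | succ k =>
        refine (haltTime_eq_succ_iff.2 ⟨?_, fun m hm hh => key e m (.inl ⟨.inr ?_, hh⟩)⟩).symm
        · by_contra hh
          exact key e k (.inr ⟨hv, hh⟩)
        · omega
    · rintro rfl n ⟨⟨e, v⟩, m, h1, h2⟩
      simp only [initSeg_getElem?] at h1
      split_ifs at h1
      simp only [Option.some.injEq] at h1
      simp only [initSeg_length] at h2
      rcases h2 with ⟨h0 | h0, hh⟩ | ⟨h0, hh⟩
      · exact haltTime_eq_zero_iff.1 (h1.trans h0) m hh
      · obtain ⟨k, rfl⟩ : ∃ k, v = k + 1 := ⟨v - 1, by omega⟩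
        exact (haltTime_eq_succ_iff.1 h1).2 m (by omega) hh
      · exact hh (haltTime_eq_succ_iff.1 (h1.trans h0)).1

theorem tredIn_jump_haltTime (B : ℕ → ℕ) : TRedIn (jump B) (haltTime B) := by
  refine .jump_of_sigmaOneIn ?_ ?_
  · refine (SigmaOneIn.exists_nat (R := fun e k => haltTime B e = k + 1)
      ((SigmaOneIn.oracle (haltTime B)).comp (Primrec.fst.pair
        (Primrec.succ.comp Primrec.snd)))).of_iff fun e => ?_
    rw [dom_iff_haltsBy]
    constructor
    · intro h
      exact ⟨haltTime B e - 1, by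
        have : haltTime B e ≠ 0 := fun h0 => by
          obtain ⟨n, hn⟩ := h
          exact haltTime_eq_zero_iff.1 h0 n hn
        omega⟩
    · rintro ⟨k, hk⟩
      exact ⟨k, (haltTime_eq_succ_iff.1 hk).1⟩
  · refine ((SigmaOneIn.oracle (haltTime B)).comp (Primrec.id.pair (Primrec.const 0))).of_iff
      fun e => ?_
    rw [dom_iff_haltsBy, id, haltTime_eq_zero_iff, not_exists]

theorem tredIn_haltTime_jump (B : ℕ → ℕ) : TRedIn (haltTime B) (jump B) := by
  refine tredIn_iff.2 ?_
  have h0 : SigmaOneIn (jump B) fun p : ℕ × ℕ =>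
      ¬ (evalo B (OCode.ofNat p.1) p.1).Dom ∧ p.2 = 0 :=
    ((sigmaOneIn_dom B).not_jump.comp Primrec.fst).and
      (.of_primrec (Primrec.eq.comp Primrec.snd (Primrec.const 0)))
  have h1 : SigmaOneIn (jump B) fun p : ℕ × ℕ => ∃ k, p.2 = (initSeg B k).length + 1 ∧
      haltsBy p.1 (initSeg B k) ∧
      ∀ m < (initSeg B k).length, ¬ haltsBy p.1 ((initSeg B k).take m) := by
    refine SigmaOneIn.jump ⟨fun p γ => p.2 = γ.length + 1 ∧ haltsBy p.1 γ ∧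
      ∀ m < γ.length, ¬ haltsBy p.1 (γ.take m), PrimrecPred.and (Primrec.eq.comp
        (Primrec.snd.comp Primrec.fst) (Primrec.succ.comp (Primrec.list_length.comp Primrec.snd)))
      (PrimrecPred.and (primrecRel_haltsBy.comp (Primrec.fst.comp Primrec.fst) Primrec.snd) ?_),
      fun p => Iff.rfl⟩
    have : PrimrecRel fun (n : ℕ) (q : (ℕ × ℕ) × List ℕ) =>
        ∀ m < n, ¬ haltsBy q.1.1 (q.2.take m) := by
      refine primrecRel_forall_lt (R := fun m (q : (ℕ × ℕ) × List ℕ) =>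
        ¬ haltsBy q.1.1 (q.2.take m)) (PrimrecPred.not ?_)
      exact primrecRel_haltsBy.comp (Primrec.fst.comp (Primrec.fst.comp Primrec.snd))
        (Primrec.list_take.comp Primrec.fst (Primrec.snd.comp Primrec.snd))
    exact this.comp (Primrec.list_length.comp Primrec.snd) Primrec.id
  refine (h0.or h1).of_iff fun ⟨e, v⟩ => ?_
  rw [dom_iff_haltsBy, not_exists]
  dsimp only
  constructor
  · rintro rfl
    cases hv : haltTime B e with
    | zero => exact .inl ⟨haltTime_eq_zero_iff.1 hv, rfl⟩
    | succ k =>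
      obtain ⟨h2, h3⟩ := haltTime_eq_succ_iff.1 hv
      refine .inr ⟨k, by simp, h2, fun m hm => ?_⟩
      rw [initSeg_length] at hm
      rw [initSeg_take _ hm.le]
      exact h3 m hm
  · rintro (⟨h, rfl⟩ | ⟨k, rfl, h2, h3⟩)
    · exact haltTime_eq_zero_iff.2 h
    · rw [initSeg_length] at h3 ⊢
      refine haltTime_eq_succ_iff.2 ⟨h2, fun m hm => ?_⟩
      have := h3 m hm
      rwa [initSeg_take _ hm.le] at this

/-- `σ` and `δ` consist of initial even and odd entries of `τ`. -/
def JoinPart (τ σ δ : List ℕ) : Prop :=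
  (∀ i < σ.length, τ[2 * i]? = σ[i]?) ∧ ∀ i < δ.length, τ[2 * i + 1]? = δ[i]?

theorem primrecPred_joinPart :
    PrimrecPred fun p : List ℕ × List ℕ × List ℕ => JoinPart p.1 p.2.1 p.2.2 := by
  have h1 : Primrec fun p : ℕ × List ℕ × List ℕ × List ℕ => 2 * p.1 :=
    Primrec.nat_mul.comp (Primrec.const 2) Primrec.fst
  have h2 : PrimrecRel fun (n : ℕ) (q : List ℕ × List ℕ × List ℕ) =>
      ∀ i < n, q.1[2 * i]? = q.2.1[i]? :=
    primrecRel_forall_lt (R := fun i (q : List ℕ × List ℕ × List ℕ) => q.1[2 * i]? = q.2.1[i]?)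
      (Primrec.eq.comp (Primrec.list_getElem?.comp (Primrec.fst.comp Primrec.snd) h1)
        (Primrec.list_getElem?.comp (Primrec.fst.comp (Primrec.snd.comp Primrec.snd)) Primrec.fst))
  have h3 : PrimrecRel fun (n : ℕ) (q : List ℕ × List ℕ × List ℕ) =>
      ∀ i < n, q.1[2 * i + 1]? = q.2.2[i]? :=
    primrecRel_forall_lt (R := fun i (q : List ℕ × List ℕ × List ℕ) =>
        q.1[2 * i + 1]? = q.2.2[i]?)
      (Primrec.eq.comp (Primrec.list_getElem?.comp (Primrec.fst.comp Primrec.snd)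
        (Primrec.succ.comp h1))
        (Primrec.list_getElem?.comp (Primrec.snd.comp (Primrec.snd.comp Primrec.snd)) Primrec.fst))
  exact PrimrecPred.and (h2.comp (Primrec.list_length.comp (Primrec.fst.comp Primrec.snd))
    Primrec.id) (h3.comp (Primrec.list_length.comp (Primrec.snd.comp Primrec.snd)) Primrec.id)

theorem eq_initSeg_iff {σ : List ℕ} {X : ℕ → ℕ} :
    σ = initSeg X σ.length ↔ ∀ i < σ.length, some (X i) = σ[i]? := by
  constructor
  · intro h i hi
    rw [h, initSeg_getElem?, if_pos (by simpa using hi)]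
  · intro h
    refine List.ext_getElem? fun i => ?_
    rw [initSeg_getElem?]
    split_ifs with hi
    · exact (h i hi).symm
    · simpa using hi

theorem exists_joinPart_iff {X Y : ℕ → ℕ} {σ δ : List ℕ} :
    (∃ n, JoinPart (initSeg (oplus X Y) n) σ δ) ↔
      σ = initSeg X σ.length ∧ δ = initSeg Y δ.length := by
  simp only [eq_initSeg_iff, JoinPart]
  constructor
  · rintro ⟨n, h1, h2⟩
    constructor
    · intro i hi
      have := h1 i hi
      rw [initSeg_getElem?, List.getElem?_eq_getElem hi, oplus_even] at this
      split_ifs at this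
      rw [List.getElem?_eq_getElem hi, this]
    · intro i hi
      have := h2 i hi
      rw [initSeg_getElem?, List.getElem?_eq_getElem hi, oplus_odd] at this
      split_ifs at this
      rw [List.getElem?_eq_getElem hi, this]
  · rintro ⟨h1, h2⟩
    refine ⟨2 * (σ.length + δ.length), fun i hi => ?_, fun i hi => ?_⟩
    · rw [initSeg_getElem?, if_pos (by omega), oplus_even, h1 i hi]
    · rw [initSeg_getElem?, if_pos (by omega), oplus_odd, h2 i hi]

theorem exists_oplus_eq (Z : ℕ → ℕ) : ∃ X Y, Z = oplus X Y := by
  refine ⟨fun n => Z (2 * n), fun n => Z (2 * n + 1), ?_⟩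
  funext n
  rcases Nat.even_or_odd' n with ⟨k, rfl | rfl⟩
  · rw [oplus_even]
  · rw [oplus_odd]

theorem oplus_inj {X Y X' Y' : ℕ → ℕ} : oplus X Y = oplus X' Y' ↔ X = X' ∧ Y = Y' := by
  constructor
  · intro h
    constructor
    · funext n
      rw [← oplus_even X Y, h, oplus_even]
    · funext n
      rw [← oplus_odd X Y, h, oplus_odd]
  · rintro ⟨rfl, rfl⟩
    rfl

/-- A `Π⁰₁` singleton relative to a jump becomes `Π⁰₁` after adjoining the halting times. -/
theorem IsPi01Singleton.oplus_haltTime {B X : ℕ → ℕ} (h : IsPi01Singleton (jump B) X) :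
    IsPi01Singleton B (oplus X (haltTime B)) := by
  obtain ⟨K, hK, hX⟩ := h
  obtain ⟨L, hL, hW⟩ := isPi01Singleton_haltTime B
  obtain ⟨r, hr, h⟩ := hK.mono (tredIn_jump_haltTime B)
  refine ⟨fun τ => ∃ p : List ℕ × List ℕ, JoinPart τ p.1 p.2 ∧ (L p.2 ∨ r p.1 p.2), ?_,
    fun Z => ?_⟩
  · refine SigmaOneIn.exists_mem (R := fun τ (p : List ℕ × List ℕ) =>
      JoinPart τ p.1 p.2 ∧ (L p.2 ∨ r p.1 p.2)) (.and (.of_primrec primrecPred_joinPart)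
      (.or (hL.comp (Primrec.snd.comp Primrec.snd)) ?_))
    exact .of_primrec (hr.comp (Primrec.fst.comp Primrec.snd) (Primrec.snd.comp Primrec.snd))
  · obtain ⟨Z, W, rfl⟩ := exists_oplus_eq Z
    have hrw : (∀ n, ¬ ∃ p : List ℕ × List ℕ, JoinPart (initSeg (oplus Z W) n) p.1 p.2 ∧
        (L p.2 ∨ r p.1 p.2)) ↔
        ∀ k n, ¬ (L (initSeg W n) ∨ r (initSeg Z k) (initSeg W n)) := by
      constructor
      · intro H k n hkn
        obtain ⟨m, hm⟩ := exists_joinPart_iff.2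
          ⟨show initSeg Z k = initSeg Z (initSeg Z k).length by simp,
            show initSeg W n = initSeg W (initSeg W n).length by simp⟩
        exact H m ⟨(_, _), hm, hkn⟩
      · rintro H n ⟨⟨σ, δ⟩, h1, h2⟩
        obtain ⟨h3, h4⟩ := exists_joinPart_iff.1 ⟨n, h1⟩
        apply H σ.length δ.length
        rwa [← h3, ← h4]
    rw [oplus_inj, hrw]
    constructor
    · intro H
      obtain rfl : W = haltTime B := (hW W).1 fun n hn => H 0 n (.inl hn)
      refine ⟨(hX Z).1 fun k hk => ?_, rfl⟩
      obtain ⟨n, hn⟩ := (h _).1 hk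
      exact H k n (.inr hn)
    · rintro ⟨rfl, rfl⟩ k n (hn | hn)
      · exact (hW _).2 rfl n hn
      · exact (hX _).2 rfl k ((h _).2 ⟨n, hn⟩)

/-- A stagewise construction of a treemap by finite injury.  Strings in the range carry tags
recording the stage at which they were introduced. -/
structure TagConstruction where
  F : ℕ → List ℕ → List ℕ
  act : ℕ → Option (List ℕ × List ℕ)
  conv : List ℕ → ℕ → List ℕ → Prop
  alive : ℕ → List ℕ → Prop
  zero : ∀ σ, F 0 σ = σ.map (Nat.pair · 0)
  none : ∀ t, act t = none → F (t + 1) = F t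
  some : ∀ t η ρ, act t = some (η, ρ) → ∀ σ, F (t + 1) σ = if η <+: σ then
    F t (η ++ ρ) ++ (σ.drop η.length).map (Nat.pair · (t + 1)) else F t σ
  act_alive : ∀ t η ρ, act t = Option.some (η, ρ) → alive t (η ++ ρ)
  act_not_conv : ∀ t η ρ, act t = Option.some (η, ρ) → ¬ conv η t (F t η)
  act_conv : ∀ t η ρ, act t = Option.some (η, ρ) → conv η t (F t (η ++ ρ))
  fair : ∀ η ρ s, ∃ t ≥ s, ¬ conv η t (F t η) → conv η t (F t (η ++ ρ)) → alive t (η ++ ρ) →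
    act t = Option.some (η, ρ)
  alive_mono : ∀ t' t σ ξ, t' ≤ t → σ <+: ξ → alive t ξ → alive t' σ
  conv_mono : ∀ η t t' τ τ', t ≤ t' → τ <+: τ' → conv η t τ → conv η t' τ'

/-- Maps of strings that code the input in the first components of their entries. -/
def TagTreemap (F : List ℕ → List ℕ) (t : ℕ) : Prop :=
  ∀ σ x, ∃ m ≤ t, F σ ++ [Nat.pair x m] <+: F (σ ++ [x])

namespace TagTreemap

variable {F : List ℕ → List ℕ} {t : ℕ}

theorem mono (h : TagTreemap F t) {σ ξ : List ℕ} (hσ : σ <+: ξ) : F σ <+: F ξ := by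
  obtain ⟨ρ, rfl⟩ := hσ
  induction ρ using List.reverseRecOn with
  | nil => simp
  | append_singleton ρ x ih =>
    obtain ⟨m, -, hm⟩ := h (σ ++ ρ) x
    rw [← List.append_assoc]
    exact ih.trans ((List.prefix_append _ _).trans hm)

theorem extend (h : TagTreemap F t) {σ ξ : List ℕ} {x : ℕ} (hσ : σ ++ [x] <+: ξ) :
    ∃ m ≤ t, F σ ++ [Nat.pair x m] <+: F ξ := by
  obtain ⟨m, hm, h1⟩ := h σ x
  exact ⟨m, hm, h1.trans (h.mono hσ)⟩

theorem length_le (h : TagTreemap F t) (σ : List ℕ) : σ.length ≤ (F σ).length := by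
  induction σ using List.reverseRecOn with
  | nil => simp
  | append_singleton σ x ih =>
    obtain ⟨m, -, hm⟩ := h σ x
    have := hm.length_le
    simp at this ⊢
    omega

/-- Strings with comparable images are comparable. -/
theorem comparable (h : TagTreemap F t) {σ ξ τ : List ℕ} (hσ : F σ <+: τ) (hξ : F ξ <+: τ) :
    σ <+: ξ ∨ ξ <+: σ := by
  induction σ using List.reverseRecOn with
  | nil => exact .inl (List.nil_prefix)
  | append_singleton σ x ih =>
    obtain ⟨m, -, hm⟩ := h σ x
    rcases ih (((List.prefix_append _ _).trans hm).trans hσ) with ⟨ρ, rfl⟩ | h1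
    · cases ρ with
      | nil => exact .inr (by simp)
      | cons y ρ =>
        left
        obtain ⟨m', -, hm'⟩ := h.extend (σ := σ) (ξ := σ ++ y :: ρ) (x := y) ⟨ρ, by simp⟩
        have h1 := List.prefix_of_prefix_length_le (hm.trans hσ) (hm'.trans hξ) (by simp)
        have h2 := h1.eq_of_length (by simp)
        simp at h2
        obtain ⟨rfl, -⟩ := h2
        exact ⟨ρ, by simp⟩
    · exact .inr (h1.trans (List.prefix_append _ _))

theorem prefix_of_image (h : TagTreemap F t) {σ ξ : List ℕ} (hσ : F σ <+: F ξ) : σ <+: ξ := by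
  rcases h.comparable hσ List.prefix_rfl with h1 | ⟨ρ, rfl⟩
  · exact h1
  · cases ρ with
    | nil => simp
    | cons y ρ =>
      obtain ⟨m', -, hm'⟩ := h.extend (σ := ξ) (ξ := ξ ++ y :: ρ) (x := y) ⟨ρ, by simp⟩
      have := (hm'.trans hσ).length_le
      simp at this

theorem prefix_of_append (h : TagTreemap F t) {σ ξ : List ℕ} {x m : ℕ}
    (hσ : F σ ++ [Nat.pair x m] <+: F ξ) : σ ++ [x] <+: ξ := by
  obtain ⟨ρ, rfl⟩ := h.prefix_of_image ((List.prefix_append _ _).trans hσ)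
  cases ρ with
  | nil =>
    have := hσ.length_le
    simp at this
  | cons y ρ =>
    obtain ⟨m', -, hm'⟩ := h.extend (σ := σ) (ξ := σ ++ y :: ρ) (x := y) ⟨ρ, by simp⟩
    have h1 := List.prefix_of_prefix_length_le hσ hm' (by simp)
    have h2 := h1.eq_of_length (by simp)
    simp at h2
    obtain ⟨rfl, -⟩ := h2
    exact ⟨ρ, by simp⟩

end TagTreemap

namespace TagConstruction

variable (𝒞 : TagConstruction)

theorem cases_succ (t : ℕ) : 𝒞.F (t + 1) = 𝒞.F t ∨ ∃ η ρ, 𝒞.act t = Option.some (η, ρ) := by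
  rcases h : 𝒞.act t with _ | ⟨η, ρ⟩
  · exact .inl (𝒞.none t h)
  · exact .inr ⟨η, ρ, rfl⟩

theorem treemap (t : ℕ) : TagTreemap (𝒞.F t) t := by
  induction t with
  | zero => intro σ x; exact ⟨0, le_rfl, by simp [𝒞.zero]⟩
  | succ t ih =>
    intro σ x
    rcases 𝒞.cases_succ t with h | ⟨η, ρ, h⟩
    · rw [h]
      obtain ⟨m, hm, h1⟩ := ih σ x
      exact ⟨m, by omega, h1⟩
    · rw [𝒞.some t η ρ h, 𝒞.some t η ρ h]
      by_cases h1 : η <+: σ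
      · refine ⟨t + 1, le_rfl, ?_⟩
        rw [if_pos h1, if_pos (h1.trans (List.prefix_append _ _)),
          List.drop_append_of_le_length h1.length_le]
        simp
      · rw [if_neg h1]
        split_ifs with h2
        · rcases List.prefix_concat_iff.1 h2 with rfl | h3
          · obtain ⟨m, hm, h4⟩ := ih.extend (σ := σ) (x := x) (List.prefix_append (σ ++ [x]) ρ)
            exact ⟨m, by omega, h4.trans (List.prefix_append _ _)⟩
          · exact absurd h3 h1
        · obtain ⟨m, hm, h1⟩ := ih σ x
          exact ⟨m, by omega, h1⟩

theorem tag_le (t : ℕ) : ∀ σ, ∀ v ∈ 𝒞.F t σ, v.unpair.2 ≤ t := by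
  induction t with
  | zero => simp [𝒞.zero]
  | succ t ih =>
    intro σ v hv
    rcases 𝒞.cases_succ t with h | ⟨η, ρ, h⟩
    · rw [h] at hv
      exact (ih σ v hv).trans (Nat.le_succ t)
    · rw [𝒞.some t η ρ h] at hv
      split_ifs at hv
      · rcases List.mem_append.1 hv with hv | hv
        · exact (ih _ v hv).trans (Nat.le_succ t)
        · obtain ⟨x, -, rfl⟩ := List.mem_map.1 hv
          simp
      · exact (ih σ v hv).trans (Nat.le_succ t)

theorem nil_persists {t' t : ℕ} (ht : t' ≤ t) : ∀ ξ, 𝒞.F t' [] <+: 𝒞.F t ξ := by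
  induction t, ht using Nat.le_induction with
  | base => exact fun ξ => (𝒞.treemap t').mono List.nil_prefix
  | succ t ht ih =>
    intro ξ
    rcases 𝒞.cases_succ t with h | ⟨η, ρ, h⟩
    · rw [h]
      exact ih ξ
    · rw [𝒞.some t η ρ h]
      split_ifs
      · exact (ih _).trans (List.prefix_append _ _)
      · exact ih ξ

theorem prefix_of_tag_lt {α ζ l : List ℕ} {v s : ℕ} (h : α ++ [v] <+: l ++ ζ.map (Nat.pair · s))
    (hv : v.unpair.2 < s) : α ++ [v] <+: l := by
  rcases List.prefix_or_prefix_of_prefix h (List.prefix_append l _) with h1 | ⟨δ, hδ⟩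
  · exact h1
  · rw [← hδ] at h ⊢
    rw [List.prefix_append_right_inj] at h
    rcases List.eq_nil_or_concat δ with rfl | ⟨δ', w, rfl⟩
    · simp
    · exfalso
      have h1 : v = w := by
        have := congrArg List.getLast? hδ
        simpa using this.symm
      have := h.subset (a := w) (by simp)
      obtain ⟨x, -, rfl⟩ := List.mem_map.1 this
      rw [h1, Nat.unpair_pair] at hv
      exact lt_irrefl _ hv

theorem extend_persists {t' t : ℕ} (ht : t' ≤ t) {σ : List ℕ} {x m : ℕ} (hm : m ≤ t') :
    ∀ ξ, 𝒞.F t' σ ++ [Nat.pair x m] <+: 𝒞.F t ξ → 𝒞.F t' (σ ++ [x]) <+: 𝒞.F t ξ := by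
  induction t, ht using Nat.le_induction with
  | base => exact fun ξ h => (𝒞.treemap t').mono ((𝒞.treemap t').prefix_of_append h)
  | succ t ht ih =>
    intro ξ hξ
    rcases 𝒞.cases_succ t with h | ⟨η, ρ, h⟩
    · rw [h] at hξ ⊢
      exact ih ξ hξ
    · rw [𝒞.some t η ρ h] at hξ ⊢
      split_ifs at hξ ⊢
      · refine (ih _ (prefix_of_tag_lt hξ ?_)).trans (List.prefix_append _ _)
        rw [Nat.unpair_pair]
        exact Nat.lt_succ_of_le (hm.trans ht)
      · exact ih ξ hξ

theorem alive_of_initial {t' t : ℕ} (ht : t' ≤ t) {σ : List ℕ} :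
    ∀ ξ, 𝒞.alive t ξ → 𝒞.F t' σ <+: 𝒞.F t ξ → 𝒞.alive t' σ := by
  induction t, ht using Nat.le_induction with
  | base => exact fun ξ h h1 => 𝒞.alive_mono _ _ _ _ le_rfl ((𝒞.treemap t').prefix_of_image h1) h
  | succ t ht ih =>
    intro ξ hal hξ
    have hal' := 𝒞.alive_mono t _ _ _ (Nat.le_succ t) List.prefix_rfl hal
    rcases 𝒞.cases_succ t with h | ⟨η, ρ, h⟩
    · rw [h] at hξ
      exact ih ξ hal' hξ
    · rw [𝒞.some t η ρ h] at hξ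
      split_ifs at hξ
      · refine ih _ (𝒞.act_alive t η ρ h) ?_
        rcases List.eq_nil_or_concat (𝒞.F t' σ) with h0 | ⟨α, v, hv⟩
        · simp [h0]
        · have htag := 𝒞.tag_le t' σ v (by simp [hv])
          rw [hv, List.concat_eq_append] at hξ ⊢
          exact prefix_of_tag_lt hξ (Nat.lt_succ_of_le (htag.trans ht))
      · exact ih ξ hal' hξ

theorem F_succ_eq {t : ℕ} {σ : List ℕ}
    (h : ∀ η ρ, η <+: σ → 𝒞.act t ≠ Option.some (η, ρ)) : 𝒞.F (t + 1) σ = 𝒞.F t σ := by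
  rcases 𝒞.cases_succ t with h1 | ⟨η, ρ, h1⟩
  · rw [h1]
  · rw [𝒞.some t η ρ h1, if_neg fun h2 => h η ρ h2 h1]

theorem stops_of_proper {σ : List ℕ} {s : ℕ}
    (hs : ∀ t ≥ s, ∀ η ρ, η <+: σ → η ≠ σ → 𝒞.act t ≠ Option.some (η, ρ)) :
    ∃ s', ∀ t ≥ s', ∀ η ρ, η <+: σ → 𝒞.act t ≠ Option.some (η, ρ) := by
  by_cases h : ∃ t ≥ s, ∃ ρ, 𝒞.act t = Option.some (σ, ρ)
  · obtain ⟨t₀, ht₀, ρ₀, h₀⟩ := h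
    have key : ∀ t ≥ t₀ + 1, 𝒞.conv σ t (𝒞.F t σ) := by
      intro t ht
      induction t, ht using Nat.le_induction with
      | base =>
        refine 𝒞.conv_mono _ _ _ _ _ (Nat.le_succ t₀) ?_ (𝒞.act_conv t₀ σ ρ₀ h₀)
        rw [𝒞.some t₀ σ ρ₀ h₀, if_pos List.prefix_rfl]
        exact List.prefix_append _ _
      | succ t ht ih =>
        refine 𝒞.conv_mono _ _ _ _ _ (Nat.le_succ t) ?_ ih
        rw [𝒞.F_succ_eq]
        intro η ρ hη hact
        rcases eq_or_ne η σ with rfl | hne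
        · exact 𝒞.act_not_conv t _ ρ hact ih
        · exact hs t (by omega) η ρ hη hne hact
    refine ⟨t₀ + 1, fun t ht η ρ hη hact => ?_⟩
    rcases eq_or_ne η σ with rfl | hne
    · exact 𝒞.act_not_conv t _ ρ hact (key t ht)
    · exact hs t (by omega) η ρ hη hne hact
  · refine ⟨s, fun t ht η ρ hη hact => ?_⟩
    rcases eq_or_ne η σ with rfl | hne
    · exact h ⟨t, ht, ρ, hact⟩
    · exact hs t ht η ρ hη hne hact

theorem eventually_stops (σ : List ℕ) :
    ∃ s, ∀ t ≥ s, ∀ η ρ, η <+: σ → 𝒞.act t ≠ Option.some (η, ρ) := by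
  induction σ using List.reverseRecOn with
  | nil => exact 𝒞.stops_of_proper (s := 0) fun t _ η ρ hη hne => absurd (List.prefix_nil.1 hη) hne
  | append_singleton σ x ih =>
    obtain ⟨s, hs⟩ := ih
    refine 𝒞.stops_of_proper (s := s) fun t ht η ρ hη hne => hs t ht η ρ ?_
    exact (List.prefix_concat_iff.1 hη).resolve_left hne

theorem exists_limit (σ : List ℕ) : ∃ τ s, ∀ t ≥ s, 𝒞.F t σ = τ := by
  obtain ⟨s, hs⟩ := 𝒞.eventually_stops σ
  refine ⟨𝒞.F s σ, s, fun t ht => ?_⟩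
  induction t, ht using Nat.le_induction with
  | base => rfl
  | succ t ht ih => rw [𝒞.F_succ_eq (hs t ht), ih]

/-- The limit treemap. -/
noncomputable def lim (σ : List ℕ) : List ℕ := Classical.choose (𝒞.exists_limit σ)

theorem exists_eq_lim (σ : List ℕ) : ∃ s, ∀ t ≥ s, 𝒞.F t σ = 𝒞.lim σ :=
  Classical.choose_spec (𝒞.exists_limit σ)

theorem lim_eq_iff {σ τ : List ℕ} : 𝒞.lim σ = τ ↔ ∃ s, ∀ t ≥ s, 𝒞.F t σ = τ := by
  constructor
  · rintro rfl
    exact 𝒞.exists_eq_lim σ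
  · rintro ⟨s, hs⟩
    obtain ⟨s', hs'⟩ := 𝒞.exists_eq_lim σ
    rw [← hs' (max s s') (le_max_right _ _), hs _ (le_max_left _ _)]

theorem exists_stage (σ ξ : List ℕ) (s : ℕ) :
    ∃ s' ≥ s, ∀ t ≥ s', 𝒞.F t σ = 𝒞.lim σ ∧ 𝒞.F t ξ = 𝒞.lim ξ := by
  obtain ⟨s₁, h₁⟩ := 𝒞.exists_eq_lim σ
  obtain ⟨s₂, h₂⟩ := 𝒞.exists_eq_lim ξ
  exact ⟨max s (max s₁ s₂), le_max_left _ _, fun t ht => ⟨h₁ t (by omega), h₂ t (by omega)⟩⟩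

end TagConstruction

theorem prefix_initSeg_iff {τ : List ℕ} {Z : ℕ → ℕ} {n : ℕ} (hn : τ.length ≤ n) :
    τ <+: initSeg Z n ↔ τ = initSeg Z τ.length := by
  rw [List.prefix_iff_eq_take, initSeg_take _ hn]

theorem eq_initSeg_of_initial {τ : List ℕ} {Z : ℕ → ℕ} {n : ℕ} (h : τ <+: initSeg Z n) :
    τ = initSeg Z τ.length :=
  (prefix_initSeg_iff (by simpa using h.length_le)).1 h

theorem initSeg_succ (X : ℕ → ℕ) (n : ℕ) : initSeg X (n + 1) = initSeg X n ++ [X n] := by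
  simp [initSeg, List.range_succ]

namespace TagConstruction

variable (𝒞 : TagConstruction)

theorem lim_mono {σ ξ : List ℕ} (h : σ <+: ξ) : 𝒞.lim σ <+: 𝒞.lim ξ := by
  obtain ⟨s, -, hs⟩ := 𝒞.exists_stage σ ξ 0
  rw [← (hs s le_rfl).1, ← (hs s le_rfl).2]
  exact (𝒞.treemap s).mono h

theorem lim_comparable {σ ξ τ : List ℕ} (hσ : 𝒞.lim σ <+: τ) (hξ : 𝒞.lim ξ <+: τ) :
    σ <+: ξ ∨ ξ <+: σ := by
  obtain ⟨s, -, hs⟩ := 𝒞.exists_stage σ ξ 0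
  rw [← (hs s le_rfl).1] at hσ
  rw [← (hs s le_rfl).2] at hξ
  exact (𝒞.treemap s).comparable hσ hξ

theorem length_le_lim (σ : List ℕ) : σ.length ≤ (𝒞.lim σ).length := by
  obtain ⟨s, hs⟩ := 𝒞.exists_eq_lim σ
  rw [← hs s le_rfl]
  exact (𝒞.treemap s).length_le σ

theorem lim_initSeg (X : ℕ → ℕ) (k : ℕ) :
    𝒞.lim (initSeg X k) = initSeg (pathMap 𝒞.lim X) (𝒞.lim (initSeg X k)).length := by
  rw [eq_initSeg_iff]
  intro i hi
  have hi' : i < (𝒞.lim (initSeg X (i + 1))).length := by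
    have := 𝒞.length_le_lim (initSeg X (i + 1))
    rw [initSeg_length] at this
    omega
  have h1 : Option.some (pathMap 𝒞.lim X i) = (𝒞.lim (initSeg X (i + 1)))[i]? := by
    simp [pathMap, List.getD, hi']
  rw [h1]
  rcases le_total k (i + 1) with h | h
  · obtain ⟨ρ, hρ⟩ := 𝒞.lim_mono (initSeg_mono X h)
    rw [← hρ, List.getElem?_append_left hi]
  · obtain ⟨ρ, hρ⟩ := 𝒞.lim_mono (initSeg_mono X h)
    rw [← hρ, List.getElem?_append_left hi']

theorem initSeg_prefix_lim (X : ℕ → ℕ) {n k : ℕ} (h : n ≤ k) :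
    initSeg (pathMap 𝒞.lim X) n <+: 𝒞.lim (initSeg X k) := by
  rw [𝒞.lim_initSeg]
  refine initSeg_mono _ (h.trans ?_)
  simpa using 𝒞.length_le_lim (initSeg X k)

theorem eq_pathMap {X Z : ℕ → ℕ}
    (h : ∀ k, 𝒞.lim (initSeg X k) = initSeg Z (𝒞.lim (initSeg X k)).length) :
    Z = pathMap 𝒞.lim X := by
  funext i
  have h1 := 𝒞.initSeg_prefix_lim X (le_refl (i + 1))
  rw [h (i + 1)] at h1
  have h2 := eq_initSeg_of_initial h1
  rw [initSeg_length] at h2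
  have h3 := congrArg (fun l => l[i]?) h2
  simp only [initSeg_getElem?, Nat.lt_succ_self, if_true, Option.some.injEq] at h3
  exact h3.symm

theorem lim_eq_initSeg_pathMap_iff {X : ℕ → ℕ} {σ : List ℕ} :
    𝒞.lim σ = initSeg (pathMap 𝒞.lim X) (𝒞.lim σ).length ↔ σ = initSeg X σ.length := by
  constructor
  · intro h
    have h1 : 𝒞.lim σ <+: 𝒞.lim (initSeg X (max σ.length (𝒞.lim σ).length)) := by
      conv_lhs => rw [h]
      exact 𝒞.initSeg_prefix_lim X (le_max_right _ _)
    have h2 := (𝒞.lim_comparable h1 List.prefix_rfl)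
    refine (prefix_initSeg_iff (le_max_left σ.length (𝒞.lim σ).length)).1 (h2.elim id fun h3 => ?_)
    have := h3.length_le
    rw [initSeg_length] at this
    rw [h3.eq_of_length (by rw [initSeg_length]; omega)]
  · intro h
    rw [h]
    exact 𝒞.lim_initSeg X _

/-- The evidence that `τ` is not an initial segment of a path in the image of the limit map. -/
def Kill (p : ℕ × List ℕ × ℕ) (τ : List ℕ) : Prop :=
  ((𝒞.F p.1 []).length ≤ τ.length ∧ ¬ 𝒞.F p.1 [] <+: τ) ∨
  (𝒞.F p.1 p.2.1 <+: τ ∧ ((¬ 𝒞.alive p.1 p.2.1) ∨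
    (τ[(𝒞.F p.1 p.2.1).length]? = Option.some p.2.2 ∧ p.2.2.unpair.2 ≤ p.1 ∧
      (𝒞.F p.1 (p.2.1 ++ [p.2.2.unpair.1])).length ≤ τ.length ∧
      ¬ 𝒞.F p.1 (p.2.1 ++ [p.2.2.unpair.1]) <+: τ)))

theorem not_kill_pathMap {X : ℕ → ℕ} (hX : ∀ t k, 𝒞.alive t (initSeg X k))
    (p : ℕ × List ℕ × ℕ) (n : ℕ) : ¬ 𝒞.Kill p (initSeg (pathMap 𝒞.lim X) n) := by
  obtain ⟨t', σ, v⟩ := p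
  obtain ⟨t, ht, hs⟩ := 𝒞.exists_stage (initSeg X n) (initSeg X n) t'
  have hF : initSeg (pathMap 𝒞.lim X) n <+: 𝒞.F t (initSeg X n) := by
    rw [(hs t le_rfl).1]
    exact 𝒞.initSeg_prefix_lim X le_rfl
  rintro (⟨h1, h2⟩ | ⟨h1, h2 | ⟨h2, h3, h4, h5⟩⟩)
  · exact h2 (List.prefix_of_prefix_length_le (𝒞.nil_persists ht _) hF h1)
  · exact h2 (𝒞.alive_of_initial ht _ (hX t n) (h1.trans hF))
  · refine h5 (List.prefix_of_prefix_length_le (𝒞.extend_persists ht h3 _ ?_) hF h4)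
    rw [Nat.pair_unpair]
    refine List.IsPrefix.trans ?_ hF
    obtain ⟨ρ, hρ⟩ := h1
    dsimp only at hρ h2
    rw [← hρ] at h2 ⊢
    rw [List.prefix_append_right_inj]
    cases ρ with
    | nil => simp at h2
    | cons w ρ =>
      simp at h2
      subst h2
      exact ⟨ρ, rfl⟩

theorem exists_path_of_not_kill {Z : ℕ → ℕ} (hZ : ∀ p n, ¬ 𝒞.Kill p (initSeg Z n)) :
    ∃ X, (∀ t k, 𝒞.alive t (initSeg X k)) ∧ Z = pathMap 𝒞.lim X := by
  let S : ℕ → List ℕ := fun k =>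
    Nat.rec [] (fun _ σ => σ ++ [(Z (𝒞.lim σ).length).unpair.1]) k
  let X : ℕ → ℕ := fun k => (Z (𝒞.lim (S k)).length).unpair.1
  have hS : ∀ k, initSeg X k = S k := by
    intro k
    induction k with
    | zero => rfl
    | succ k ih => rw [initSeg_succ, ih]
  have hlim : ∀ k, 𝒞.lim (initSeg X k) = initSeg Z (𝒞.lim (initSeg X k)).length := by
    intro k
    induction k with
    | zero =>
      obtain ⟨s, hs⟩ := 𝒞.exists_eq_lim []
      have h1 := hZ (s, [], 0) (𝒞.F s []).length
      simp only [Kill, not_or, not_and, not_not] at h1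
      have h2 := h1.1 (by simp)
      change 𝒞.lim [] = initSeg Z (𝒞.lim []).length
      rw [hs s le_rfl] at h2
      exact eq_initSeg_of_initial h2
    | succ k ih =>
      set v := Z (𝒞.lim (initSeg X k)).length with hv
      have hXk : X k = v.unpair.1 := by rw [hv, hS]
      obtain ⟨t, ht, hs⟩ := 𝒞.exists_stage (initSeg X k) (initSeg X (k + 1)) v.unpair.2
      obtain ⟨h1, h2⟩ := hs t le_rfl
      set n := max ((𝒞.lim (initSeg X k)).length + 1) (𝒞.lim (initSeg X (k + 1))).length
      have h3 := hZ (t, initSeg X k, v) n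
      simp only [Kill, not_or, not_and, not_not] at h3
      rw [← hXk, ← initSeg_succ, h1, h2] at h3
      refine eq_initSeg_of_initial ((h3.2 ?_).2 ?_ ht ?_)
      · rw [prefix_initSeg_iff (by omega)]
        exact ih
      · rw [initSeg_getElem?, if_pos (by omega)]
      · rw [initSeg_length]
        exact le_max_right _ _
  refine ⟨X, fun t k => ?_, 𝒞.eq_pathMap hlim⟩
  obtain ⟨s, hs, h⟩ := 𝒞.exists_stage (initSeg X k) (initSeg X k) t
  have h1 := hZ (s, initSeg X k, 0) (𝒞.lim (initSeg X k)).length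
  simp only [Kill, not_or, not_and, not_not] at h1
  rw [(h s le_rfl).1] at h1
  refine 𝒞.alive_mono _ _ _ _ hs List.prefix_rfl (h1.2 ?_).1
  rw [← hlim k]

theorem conv_lim_iff {X : ℕ → ℕ} (hX : ∀ t k, 𝒞.alive t (initSeg X k)) (k : ℕ) :
    (∃ t, 𝒞.conv (initSeg X k) t (𝒞.lim (initSeg X k))) ↔
      ∃ t n, 𝒞.conv (initSeg X k) t (initSeg (pathMap 𝒞.lim X) n) := by
  constructor
  · rintro ⟨t, ht⟩
    rw [𝒞.lim_initSeg] at ht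
    exact ⟨t, _, ht⟩
  · rintro ⟨t₀, n, h₀⟩
    by_contra! hno
    obtain ⟨ρ, hρ⟩ := initSeg_mono X (le_max_left k n)
    obtain ⟨s₁, hs₁, h₁⟩ := 𝒞.exists_stage (initSeg X k) (initSeg X (max k n)) t₀
    obtain ⟨s₂, h₂⟩ := 𝒞.eventually_stops (initSeg X k)
    obtain ⟨t, ht, hact⟩ := 𝒞.fair (initSeg X k) ρ (max s₁ s₂)
    obtain ⟨h3, h4⟩ := h₁ t (by omega)
    refine h₂ t (by omega) _ ρ List.prefix_rfl (hact ?_ ?_ ?_)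
    · rw [h3]
      exact hno t
    · rw [hρ, h4]
      exact 𝒞.conv_mono _ _ _ _ _ (by omega) (𝒞.initSeg_prefix_lim X (le_max_right _ _)) h₀
    · rw [hρ]
      exact hX t _

end TagConstruction

/-- The initial segment of `oplus Z B` determined by initial segments of `Z` and `B`. -/
def interleave (τ β : List ℕ) : List ℕ :=
  (List.range (2 * min τ.length β.length)).map fun i =>
    if i % 2 = 0 then τ.getD (i / 2) 0 else β.getD (i / 2) 0

theorem primrec_interleave : Primrec₂ interleave := by
  have h2 : Primrec fun q : (List ℕ × List ℕ) × ℕ => q.2 / 2 :=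
    Primrec.nat_div.comp Primrec.snd (Primrec.const 2)
  refine Primrec.list_map (Primrec.list_range.comp (Primrec.nat_mul.comp (Primrec.const 2)
    (Primrec.nat_min.comp (Primrec.list_length.comp Primrec.fst)
      (Primrec.list_length.comp Primrec.snd)))) (Primrec₂.mk ?_)
  exact Primrec.ite (Primrec.eq.comp (Primrec.nat_mod.comp Primrec.snd (Primrec.const 2))
    (Primrec.const 0)) ((Primrec.list_getD 0).comp (Primrec.fst.comp Primrec.fst) h2)
    ((Primrec.list_getD 0).comp (Primrec.snd.comp Primrec.fst) h2)

theorem interleave_mono {τ τ' β β' : List ℕ} (h : τ <+: τ') (h' : β <+: β') :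
    interleave τ β <+: interleave τ' β' := by
  have hle : 2 * min τ.length β.length ≤ 2 * min τ'.length β'.length := by
    have := h.length_le
    have := h'.length_le
    omega
  rw [List.prefix_iff_eq_take]
  simp only [interleave, List.length_map, List.length_range, ← List.map_take, List.take_range,
    min_eq_left hle]
  refine List.map_congr_left fun i hi => ?_
  rw [List.mem_range] at hi
  obtain ⟨ρ, rfl⟩ := h
  obtain ⟨δ, rfl⟩ := h'
  rw [List.getD_append _ _ _ _ (by omega), List.getD_append _ _ _ _ (by omega)]

theorem interleave_initSeg (Z B : ℕ → ℕ) (m n : ℕ) :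
    interleave (initSeg Z m) (initSeg B n) = initSeg (oplus Z B) (2 * min m n) := by
  have hget : ∀ (X : ℕ → ℕ) (k i : ℕ), i < k → (initSeg X k).getD i 0 = X i := by
    intro X k i hi
    rw [List.getD_eq_getElem?_getD, initSeg_getElem?, if_pos hi]
    rfl
  simp only [interleave, initSeg_length]
  rw [initSeg.eq_1 (oplus Z B)]
  refine List.map_congr_left fun i hi => ?_
  rw [List.mem_range] at hi
  rw [hget _ _ _ (by omega), hget _ _ _ (by omega)]
  rfl

theorem dom_oplus_iff (Z B : ℕ → ℕ) (e : ℕ) :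
    (evalo (oplus Z B) (OCode.ofNat e) e).Dom ↔
      ∃ t n, haltsBy e (interleave (initSeg Z n) (initSeg B t)) := by
  simp only [dom_iff_haltsBy, interleave_initSeg]
  constructor
  · rintro ⟨n, hn⟩
    exact ⟨n, n, haltsBy_mono (initSeg_mono _ (by omega)) hn⟩
  · rintro ⟨t, n, h⟩
    exact ⟨_, h⟩

theorem primrecRel_initial : PrimrecRel fun σ τ : List ℕ => σ <+: τ :=
  (Primrec.eq.comp Primrec.fst (Primrec.list_take.comp (Primrec.list_length.comp Primrec.fst)
    Primrec.snd)).of_eq fun _ => List.prefix_iff_eq_take.symm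

theorem primrec_tag : Primrec₂ fun (σ : List ℕ) (s : ℕ) => σ.map (Nat.pair · s) :=
  Primrec.list_map Primrec.fst
    (Primrec₂.natPair.comp Primrec.snd (Primrec.snd.comp Primrec.fst)).to₂

/-- The string map after a list of actions, most recent first.  An action `(η, τ, s)` sends `η`
to `τ` and copies what follows `η`, with tag `s`. -/
noncomputable def applyActions (l : List (List ℕ × List ℕ × ℕ)) (σ : List ℕ) : List ℕ :=
  l.foldr (fun a τ => if a.1 <+: σ then a.2.1 ++ (σ.drop a.1.length).map (Nat.pair · a.2.2) else τ)
    (σ.map (Nat.pair · 0))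

theorem primrec_applyActions : Primrec₂ applyActions := by
  refine Primrec.list_foldr (f := fun p : List (List ℕ × List ℕ × ℕ) × List ℕ => p.1)
    (h := fun p q => if q.1.1 <+: p.2 then
      q.1.2.1 ++ (p.2.drop q.1.1.length).map (Nat.pair · q.1.2.2) else q.2)
    Primrec.fst (primrec_tag.comp Primrec.snd (Primrec.const 0)) (Primrec₂.mk ?_)
  have hσ : Primrec fun p : (List (List ℕ × List ℕ × ℕ) × List ℕ) ×
    (List ℕ × List ℕ × ℕ) × List ℕ => p.1.2 := Primrec.snd.comp Primrec.fst
  have ha : Primrec fun p : (List (List ℕ × List ℕ × ℕ) × List ℕ) ×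
    (List ℕ × List ℕ × ℕ) × List ℕ => p.2.1 := Primrec.fst.comp Primrec.snd
  have hη := Primrec.fst.comp ha
  exact Primrec.ite (primrecRel_initial.comp hη hσ) (Primrec.list_append.comp
    (Primrec.fst.comp (Primrec.snd.comp ha)) (primrec_tag.comp (Primrec.list_drop.comp
      (Primrec.list_length.comp hη) hσ) (Primrec.snd.comp (Primrec.snd.comp ha))))
    (Primrec.snd.comp Primrec.snd)

section Construction

variable (r : List ℕ → List ℕ → Prop)

/-- Some initial segment of `σ` is forbidden on the evidence `β`. -/
def Forbidden (β σ : List ℕ) : Prop := ∃ k < σ.length + 1, r (σ.take k) β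

/-- The strategy for `η` wishes to move the image of `η` to that of `η ++ ρ`. -/
def WantsToAct (p : (List ℕ × List ℕ) × List ℕ × List (List ℕ × List ℕ × ℕ)) : Prop :=
  ¬ haltsBy p.1.1.length (interleave (applyActions p.2.2 p.1.1) p.2.1) ∧
  haltsBy p.1.1.length (interleave (applyActions p.2.2 (p.1.1 ++ p.1.2)) p.2.1) ∧
  ¬ Forbidden r p.2.1 (p.1.1 ++ p.1.2)

/-- The action at stage `t`, if any. -/
noncomputable def nextAction (t : ℕ) (q : List ℕ × List (List ℕ × List ℕ × ℕ)) :
    Option (List ℕ × List ℕ) :=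
  (decode t.unpair.1 : Option (List ℕ × List ℕ)).bind fun p =>
    if WantsToAct r (p, q) then some p else none

/-- The list of actions after stage `t`. -/
noncomputable def addAction (t : ℕ) (q : List ℕ × List (List ℕ × List ℕ × ℕ)) :
    List (List ℕ × List ℕ × ℕ) :=
  (nextAction r t q).casesOn q.2 fun p => (p.1, applyActions q.2 (p.1 ++ p.2), t + 1) :: q.2

/-- The list of actions before stage `t`, computed from an oracle string. -/
noncomputable def actionsBefore (β : List ℕ) (t : ℕ) : List (List ℕ × List ℕ × ℕ) :=
  t.rec [] fun s l => addAction r s (β.take s, l)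

variable {r}

theorem primrecRel_forbidden (hr : PrimrecRel r) : PrimrecRel (Forbidden r) := by
  have : PrimrecRel fun (n : ℕ) (q : List ℕ × List ℕ) => ∃ k < n, r (q.2.take k) q.1 := by
    refine primrecRel_exists_lt (R := fun k (q : List ℕ × List ℕ) => r (q.2.take k) q.1) ?_
    exact hr.comp (Primrec.list_take.comp Primrec.fst (Primrec.snd.comp Primrec.snd))
      (Primrec.fst.comp Primrec.snd)
  exact this.comp (Primrec.succ.comp (Primrec.list_length.comp Primrec.snd)) Primrec.id

theorem primrecPred_wantsToAct (hr : PrimrecRel r) : PrimrecPred (WantsToAct r) := by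
  have hη : Primrec fun p : (List ℕ × List ℕ) × List ℕ × List (List ℕ × List ℕ × ℕ) => p.1.1 :=
    Primrec.fst.comp Primrec.fst
  have hηρ : Primrec fun p : (List ℕ × List ℕ) × List ℕ × List (List ℕ × List ℕ × ℕ) =>
    p.1.1 ++ p.1.2 := Primrec.list_append.comp hη (Primrec.snd.comp Primrec.fst)
  have hβ : Primrec fun p : (List ℕ × List ℕ) × List ℕ × List (List ℕ × List ℕ × ℕ) => p.2.1 :=
    Primrec.fst.comp Primrec.snd
  have hl : Primrec fun p : (List ℕ × List ℕ) × List ℕ × List (List ℕ × List ℕ × ℕ) => p.2.2 :=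
    Primrec.snd.comp Primrec.snd
  have hn := Primrec.list_length.comp hη
  exact PrimrecPred.and (PrimrecPred.not (primrecRel_haltsBy.comp hn (primrec_interleave.comp
    (primrec_applyActions.comp hl hη) hβ))) (PrimrecPred.and (primrecRel_haltsBy.comp hn
    (primrec_interleave.comp (primrec_applyActions.comp hl hηρ) hβ))
    (PrimrecPred.not ((primrecRel_forbidden hr).comp hβ hηρ)))

theorem primrec_nextAction (hr : PrimrecRel r) : Primrec₂ (nextAction r) := by
  refine Primrec.option_bind (Primrec.decode.comp (Primrec.fst.comp (Primrec.unpair.comp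
    Primrec.fst))) (Primrec₂.mk ?_)
  exact Primrec.ite ((primrecPred_wantsToAct hr).comp (Primrec.snd.pair
    (Primrec.snd.comp Primrec.fst))) (Primrec.option_some.comp Primrec.snd) (Primrec.const none)

theorem primrec_addAction (hr : PrimrecRel r) : Primrec₂ (addAction r) := by
  refine Primrec.option_casesOn (primrec_nextAction hr) (Primrec.snd.comp Primrec.snd)
    (Primrec₂.mk ?_)
  have hl : Primrec fun p : (ℕ × List ℕ × List (List ℕ × List ℕ × ℕ)) × List ℕ × List ℕ =>
    p.1.2.2 := Primrec.snd.comp (Primrec.snd.comp Primrec.fst)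
  have hη : Primrec fun p : (ℕ × List ℕ × List (List ℕ × List ℕ × ℕ)) × List ℕ × List ℕ =>
    p.2.1 := Primrec.fst.comp Primrec.snd
  exact Primrec.list_cons.comp (hη.pair ((primrec_applyActions.comp hl (Primrec.list_append.comp hη
    (Primrec.snd.comp Primrec.snd))).pair (Primrec.succ.comp (Primrec.fst.comp Primrec.fst)))) hl

theorem primrec_actionsBefore (hr : PrimrecRel r) : Primrec₂ (actionsBefore r) := by
  refine Primrec.nat_rec (f := fun _ : List ℕ => ([] : List (List ℕ × List ℕ × ℕ)))
    (g := fun β p => addAction r p.1 (β.take p.1, p.2)) (Primrec.const []) (Primrec₂.mk ?_)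
  have hs : Primrec fun p : List ℕ × ℕ × List (List ℕ × List ℕ × ℕ) => p.2.1 :=
    Primrec.fst.comp Primrec.snd
  exact (primrec_addAction hr).comp hs ((Primrec.list_take.comp hs Primrec.fst).pair
    (Primrec.snd.comp Primrec.snd))

theorem actionsBefore_initSeg (B : ℕ → ℕ) {t n m : ℕ} (hn : t ≤ n) (hm : t ≤ m) :
    actionsBefore r (initSeg B n) t = actionsBefore r (initSeg B m) t := by
  induction t with
  | zero => rfl
  | succ t ih =>
    change addAction r t (_, actionsBefore r _ t) = addAction r t (_, actionsBefore r _ t)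
    rw [ih (by omega) (by omega), initSeg_take _ (by omega), initSeg_take _ (by omega)]

theorem actionsBefore_succ (B : ℕ → ℕ) (t : ℕ) :
    actionsBefore r (initSeg B (t + 1)) (t + 1) =
      addAction r t (initSeg B t, actionsBefore r (initSeg B t) t) := by
  change addAction r t (_, actionsBefore r _ t) = _
  rw [initSeg_take _ (Nat.le_succ t), actionsBefore_initSeg B (Nat.le_succ t) le_rfl]

theorem Forbidden.mono (hmono : ∀ σ γ δ, γ <+: δ → r σ γ → r σ δ) {β β' σ σ' : List ℕ}
    (hβ : β <+: β') (hσ : σ <+: σ') (h : Forbidden r β σ) : Forbidden r β' σ' := by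
  obtain ⟨ρ, rfl⟩ := hσ
  obtain ⟨k, hk, h⟩ := h
  refine ⟨k, by simp; omega, ?_⟩
  rw [List.take_append_of_le_length (by omega)]
  exact hmono _ _ _ hβ h

variable (r) in
/-- The tag construction for controlling the jump relative to `B`. -/
noncomputable def jumpConstruction (hmono : ∀ σ γ δ, γ <+: δ → r σ γ → r σ δ) (B : ℕ → ℕ) :
    TagConstruction where
  F t := applyActions (actionsBefore r (initSeg B t) t)
  act t := nextAction r t (initSeg B t, actionsBefore r (initSeg B t) t)
  conv η t τ := haltsBy η.length (interleave τ (initSeg B t))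
  alive t σ := ¬ Forbidden r (initSeg B t) σ
  zero _ := rfl
  none t h := by
    rw [actionsBefore_succ, addAction, h]
  some t η ρ h σ := by
    rw [actionsBefore_succ, addAction, h]
    rfl
  act_alive t η ρ h := by
    simp only [nextAction, Option.bind_eq_some_iff, Option.ite_none_right_eq_some,
      Option.some.injEq] at h
    obtain ⟨_, -, h, rfl⟩ := h
    exact h.2.2
  act_not_conv t η ρ h := by
    simp only [nextAction, Option.bind_eq_some_iff, Option.ite_none_right_eq_some,
      Option.some.injEq] at h
    obtain ⟨_, -, h, rfl⟩ := h
    exact h.1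
  act_conv t η ρ h := by
    simp only [nextAction, Option.bind_eq_some_iff, Option.ite_none_right_eq_some,
      Option.some.injEq] at h
    obtain ⟨_, -, h, rfl⟩ := h
    exact h.2.1
  fair η ρ s := by
    refine ⟨Nat.pair (encode (η, ρ)) s, Nat.right_le_pair _ _, fun h1 h2 h3 => ?_⟩
    rw [nextAction, Nat.unpair_pair, Encodable.encodek, Option.bind_some]
    exact if_pos ⟨h1, h2, h3⟩
  alive_mono t' t σ ξ ht hσ h h' := h (h'.mono hmono (initSeg_mono B ht) hσ)
  conv_mono η t t' τ τ' ht hτ h := haltsBy_mono (interleave_mono hτ (initSeg_mono B ht)) h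

end Construction

section Construction

variable {r : List ℕ → List ℕ → Prop}

theorem primrec_jumpConstruction (hr : PrimrecRel r) :
    Primrec fun p : (ℕ × List ℕ) × List ℕ => applyActions (actionsBefore r p.2 p.1.1) p.1.2 :=
  primrec_applyActions.comp ((primrec_actionsBefore hr).comp Primrec.snd
    (Primrec.fst.comp Primrec.fst)) (Primrec.snd.comp Primrec.fst)

theorem sigmaOneIn_kill (hr : PrimrecRel r) (hmono : ∀ σ γ δ, γ <+: δ → r σ γ → r σ δ)
    (B : ℕ → ℕ) : SigmaOneIn B fun τ : List ℕ => ∃ p, (jumpConstruction r hmono B).Kill p τ := by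
  refine SigmaOneIn.exists_mem (R := fun τ p => (jumpConstruction r hmono B).Kill p τ) ?_
  let F : (ℕ × List ℕ) × List ℕ → List ℕ := fun p =>
    applyActions (actionsBefore r p.2 p.1.1) p.1.2
  let k : List ℕ × ℕ × List ℕ × ℕ → List ℕ → Prop := fun q γ =>
    ((F ((q.2.1, []), γ)).length ≤ q.1.length ∧ ¬ F ((q.2.1, []), γ) <+: q.1) ∨
    (F ((q.2.1, q.2.2.1), γ) <+: q.1 ∧ ((¬ ¬ Forbidden r γ q.2.2.1) ∨
      (q.1[(F ((q.2.1, q.2.2.1), γ)).length]? = Option.some q.2.2.2 ∧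
        q.2.2.2.unpair.2 ≤ q.2.1 ∧
        (F ((q.2.1, q.2.2.1 ++ [q.2.2.2.unpair.1]), γ)).length ≤ q.1.length ∧
        ¬ F ((q.2.1, q.2.2.1 ++ [q.2.2.2.unpair.1]), γ) <+: q.1)))
  have hk : PrimrecRel k := by
    have hF : Primrec F := primrec_jumpConstruction hr
    have hγ : Primrec fun q : (List ℕ × ℕ × List ℕ × ℕ) × List ℕ => q.2 := Primrec.snd
    have hτ : Primrec fun q : (List ℕ × ℕ × List ℕ × ℕ) × List ℕ => q.1.1 :=
      Primrec.fst.comp Primrec.fst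
    have ht : Primrec fun q : (List ℕ × ℕ × List ℕ × ℕ) × List ℕ => q.1.2.1 :=
      Primrec.fst.comp (Primrec.snd.comp Primrec.fst)
    have hσ : Primrec fun q : (List ℕ × ℕ × List ℕ × ℕ) × List ℕ => q.1.2.2.1 :=
      Primrec.fst.comp (Primrec.snd.comp (Primrec.snd.comp Primrec.fst))
    have hv : Primrec fun q : (List ℕ × ℕ × List ℕ × ℕ) × List ℕ => q.1.2.2.2 :=
      Primrec.snd.comp (Primrec.snd.comp (Primrec.snd.comp Primrec.fst))
    have hx := Primrec.unpair.comp hv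
    have h0 := hF.comp ((ht.pair (Primrec.const [])).pair hγ)
    have h1 := hF.comp ((ht.pair hσ).pair hγ)
    have h2 := hF.comp ((ht.pair (Primrec.list_append.comp hσ (Primrec.list_cons.comp
      (Primrec.fst.comp hx) (Primrec.const [])))).pair hγ)
    have hlen := Primrec.list_length.comp hτ
    refine PrimrecPred.or (PrimrecPred.and (Primrec.nat_le.comp (Primrec.list_length.comp h0) hlen)
      (PrimrecPred.not (primrecRel_initial.comp h0 hτ)))
      (PrimrecPred.and (primrecRel_initial.comp h1 hτ) (PrimrecPred.or
        (PrimrecPred.not (PrimrecPred.not ((primrecRel_forbidden hr).comp hγ hσ)))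
        (PrimrecPred.and (Primrec.eq.comp (Primrec.list_getElem?.comp hτ
          (Primrec.list_length.comp h1)) (Primrec.option_some.comp hv)) (PrimrecPred.and
            (Primrec.nat_le.comp (Primrec.snd.comp hx) ht) (PrimrecPred.and (Primrec.nat_le.comp
              (Primrec.list_length.comp h2) hlen) (PrimrecPred.not
                (primrecRel_initial.comp h2 hτ)))))))
  exact ((SigmaOneIn.of_primrec_initSeg hk).comp (Primrec.id.pair
    (Primrec.fst.comp Primrec.snd))).of_iff fun _ => Iff.rfl

theorem sigmaOneIn_lim (hr : PrimrecRel r) (hmono : ∀ σ γ δ, γ <+: δ → r σ γ → r σ δ)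
    (B : ℕ → ℕ) :
    SigmaOneIn (jump B) fun p : List ℕ × List ℕ => (jumpConstruction r hmono B).lim p.1 = p.2 := by
  set 𝒞 := jumpConstruction r hmono B
  have h : SigmaOneIn B fun q : (ℕ × List ℕ × List ℕ) × ℕ =>
      q.1.1 ≤ q.2 ∧ ¬ 𝒞.F q.2 q.1.2.1 = q.1.2.2 := by
    let k : (ℕ × List ℕ × List ℕ) × ℕ → List ℕ → Prop := fun q γ =>
      q.1.1 ≤ q.2 ∧ ¬ applyActions (actionsBefore r γ q.2) q.1.2.1 = q.1.2.2
    have hk : PrimrecRel k := by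
      have ht : Primrec fun q : ((ℕ × List ℕ × List ℕ) × ℕ) × List ℕ => q.1.2 :=
        Primrec.snd.comp Primrec.fst
      have hq : Primrec fun q : ((ℕ × List ℕ × List ℕ) × ℕ) × List ℕ => q.1.1.2 :=
        Primrec.snd.comp (Primrec.fst.comp Primrec.fst)
      have hs : Primrec fun q : ((ℕ × List ℕ × List ℕ) × ℕ) × List ℕ => q.1.1.1 :=
        Primrec.fst.comp (Primrec.fst.comp Primrec.fst)
      have hF := (primrec_jumpConstruction hr).comp
        ((ht.pair (Primrec.fst.comp hq)).pair Primrec.snd)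
      exact PrimrecPred.and (Primrec.nat_le.comp hs ht)
        (PrimrecPred.not (Primrec.eq.comp hF (Primrec.snd.comp hq)))
    exact ((SigmaOneIn.of_primrec_initSeg hk).comp (Primrec.id.pair Primrec.snd)).of_iff
      fun _ => Iff.rfl
  have h1 := (SigmaOneIn.exists_nat (R := fun (q : ℕ × List ℕ × List ℕ) t =>
    q.1 ≤ t ∧ ¬ 𝒞.F t q.2.1 = q.2.2) h).not_jump
  refine (SigmaOneIn.exists_nat (R := fun (p : List ℕ × List ℕ) s =>
    ¬ ∃ t, s ≤ t ∧ ¬ 𝒞.F t p.1 = p.2) (h1.comp (Primrec.snd.pair Primrec.fst))).of_iff fun p => ?_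
  rw [𝒞.lim_eq_iff]
  push Not
  rfl

end Construction

/-- Jump inversion for singletons: the jump of the new singleton is controlled by the old one. -/
theorem IsPi01Singleton.exists_jump_le {B X : ℕ → ℕ} (h : IsPi01Singleton B X) :
    ∃ Z, IsPi01Singleton B Z ∧ TRedIn X (oplus Z (jump B)) ∧
      TRedIn (jump (oplus Z B)) (oplus X (jump B)) := by
  obtain ⟨K, hK, hX⟩ := h
  obtain ⟨r, hr, hmono, hKr⟩ := hK.exists_monotone
  let 𝒞 := jumpConstruction r hmono B
  have halive : ∀ W : ℕ → ℕ, (∀ t k, 𝒞.alive t (initSeg W k)) ↔ W = X := by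
    intro W
    rw [← hX]
    simp only [hKr]
    constructor
    · rintro h k ⟨n, hn⟩
      refine h n k ⟨k, by simp, ?_⟩
      rwa [initSeg_take _ le_rfl]
    · rintro h t k ⟨j, hj, hr⟩
      rw [initSeg_length] at hj
      rw [initSeg_take _ (by omega)] at hr
      exact h j ⟨t, hr⟩
  have hXalive := (halive X).2 rfl
  have hlim : ∀ C, TRedIn (jump B) C →
      SigmaOneIn C fun p : List ℕ × List ℕ => 𝒞.lim p.1 = p.2 :=
    fun C hC => (sigmaOneIn_lim hr hmono B).mono hC
  refine ⟨pathMap 𝒞.lim X, ⟨_, sigmaOneIn_kill hr hmono B, fun Z => ?_⟩, ?_, ?_⟩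
  · constructor
    · intro hZ
      obtain ⟨W, hW, rfl⟩ := 𝒞.exists_path_of_not_kill fun p n hp => hZ n ⟨p, hp⟩
      rw [(halive W).1 hW]
    · rintro rfl n ⟨p, hp⟩
      exact 𝒞.not_kill_pathMap hXalive p n hp
  · set C := oplus (pathMap 𝒞.lim X) (jump B)
    refine tredIn_iff.2 ?_
    have hpath : SigmaOneIn C fun τ : List ℕ => τ = initSeg (pathMap 𝒞.lim X) τ.length :=
      .eq_initSeg_length (tredIn_iff.1 (tredIn_oplus_left _ _))
    have hp : Primrec fun q : (ℕ × ℕ) × List ℕ × List ℕ => q.2.1 := Primrec.fst.comp Primrec.snd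
    have hx : Primrec fun q : (ℕ × ℕ) × List ℕ × List ℕ => q.2.1 ++ [q.1.2] :=
      Primrec.list_append.comp hp (Primrec.list_cons.comp (Primrec.snd.comp Primrec.fst)
        (Primrec.const []))
    have hτ : Primrec fun q : (ℕ × ℕ) × List ℕ × List ℕ => q.2.2 := Primrec.snd.comp Primrec.snd
    refine (SigmaOneIn.exists_mem (R := fun (p : ℕ × ℕ) (q : List ℕ × List ℕ) =>
      q.1.length = p.1 ∧ 𝒞.lim (q.1 ++ [p.2]) = q.2 ∧
        q.2 = initSeg (pathMap 𝒞.lim X) q.2.length)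
      (.and (.of_primrec (Primrec.eq.comp (Primrec.list_length.comp hp)
        (Primrec.fst.comp Primrec.fst))) (.and
          ((hlim C (tredIn_oplus_right _ _)).comp (hx.pair hτ)) (hpath.comp hτ)))).of_iff ?_
    rintro ⟨k, x⟩
    constructor
    · intro h
      obtain rfl : X k = x := h
      refine ⟨(initSeg X k, 𝒞.lim (initSeg X (k + 1))), initSeg_length _ _, ?_,
        𝒞.lim_initSeg X _⟩
      rw [initSeg_succ]
    · rintro ⟨⟨σ, τ⟩, rfl, hτ, h⟩
      obtain rfl : 𝒞.lim (σ ++ [x]) = τ := hτ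
      have h1 := 𝒞.lim_eq_initSeg_pathMap_iff.1 h
      rw [List.length_append, List.length_singleton, initSeg_succ] at h1
      simpa using (List.append_inj' h1 rfl).2.symm
  · set C := oplus X (jump B)
    have hX : SigmaOneIn C fun σ : List ℕ => σ = initSeg X σ.length :=
      .eq_initSeg_length (tredIn_iff.1 (tredIn_oplus_left _ _))
    have hE : SigmaOneIn B fun p : ℕ × List ℕ =>
        ∃ t, haltsBy p.1 (interleave p.2 (initSeg B t)) := by
      refine SigmaOneIn.exists_nat (R := fun (p : ℕ × List ℕ) t =>
        haltsBy p.1 (interleave p.2 (initSeg B t))) (.of_primrec_initSeg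
          (r := fun (p : ℕ × List ℕ) γ => haltsBy p.1 (interleave p.2 γ)) ?_)
      exact primrecRel_haltsBy.comp (Primrec.fst.comp Primrec.fst)
        (primrec_interleave.comp (Primrec.snd.comp Primrec.fst) Primrec.snd)
    have key : ∀ P : ℕ → List ℕ → Prop, SigmaOneIn (jump B) (fun p : ℕ × List ℕ => P p.1 p.2) →
        SigmaOneIn C fun e => P e (𝒞.lim (initSeg X e)) := by
      intro P hP
      have hσ : Primrec fun q : ℕ × List ℕ × List ℕ => q.2.1 := Primrec.fst.comp Primrec.snd
      have hB := tredIn_oplus_right X (jump B)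
      refine (SigmaOneIn.exists_mem (R := fun (e : ℕ) (q : List ℕ × List ℕ) =>
        q.1.length = e ∧ q.1 = initSeg X q.1.length ∧ 𝒞.lim q.1 = q.2 ∧ P e q.2)
        (.and (.of_primrec (Primrec.eq.comp (Primrec.list_length.comp hσ) Primrec.fst))
          (.and (hX.comp hσ) (.and ((hlim C hB).comp Primrec.snd)
            ((hP.mono hB).comp (Primrec.fst.pair (Primrec.snd.comp Primrec.snd))))))).of_iff ?_
      intro e
      constructor
      · intro h
        exact ⟨(initSeg X e, _), initSeg_length _ _, by rw [initSeg_length], rfl, h⟩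
      · rintro ⟨⟨σ, τ⟩, rfl, h, hτ, h'⟩
        obtain rfl : 𝒞.lim σ = τ := hτ
        rwa [← h]
    have hdom : ∀ e, (evalo (oplus (pathMap 𝒞.lim X) B) (OCode.ofNat e) e).Dom ↔
        ∃ t, haltsBy e (interleave (𝒞.lim (initSeg X e)) (initSeg B t)) := by
      intro e
      have := 𝒞.conv_lim_iff hXalive e
      simp only [𝒞, jumpConstruction, initSeg_length] at this
      exact (dom_oplus_iff _ _ _).trans this.symm
    exact .jump_of_sigmaOneIn ((key (fun e τ => ∃ t, haltsBy e (interleave τ (initSeg B t)))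
      hE.jump).of_iff hdom)
      ((key (fun e τ => ¬ ∃ t, haltsBy e (interleave τ (initSeg B t)))
        hE.not_jump).of_iff fun e => not_congr (hdom e))

theorem IsPi01Singleton.exists_lift {B X : ℕ → ℕ} (h : IsPi01Singleton (jump B) X) :
    ∃ Z, IsPi01Singleton B Z ∧ TRedIn X (oplus Z (jump B)) ∧
      TRedIn (jump (oplus Z B)) (oplus X (jump B)) := by
  obtain ⟨Z, hZ, h1, h2⟩ := h.oplus_haltTime.exists_jump_le
  exact ⟨Z, hZ, (tredIn_oplus_left _ _).trans h1, h2.trans (.oplus (.oplus (tredIn_oplus_left _ _)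
    ((tredIn_haltTime_jump B).trans (tredIn_oplus_right _ _))) (tredIn_oplus_right _ _))⟩

theorem exists_isPi01Singleton_incomparable (n : ℕ) (B : ℕ → ℕ) :
    ∃ X Y, IsPi01Singleton B X ∧ IsPi01Singleton B Y ∧
      ¬ TRedIn X (jumpIter (oplus Y B) n) ∧ ¬ TRedIn Y (jumpIter (oplus X B) n) := by
  induction n generalizing B with
  | zero =>
    obtain ⟨Z, hZ, h1, h2⟩ := (isPi01Singleton_haltTime (jump B)).exists_lift
    have h3 : ∀ C, TRedIn Z C → TRedIn (jump B) C → TRedIn (jump (jump B)) C := fun C h h' =>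
      (tredIn_jump_haltTime _).trans (h1.trans (h.oplus h'))
    refine ⟨haltTime B, Z, isPi01Singleton_haltTime B, hZ, fun h => ?_, fun h => ?_⟩
    · change TRedIn _ (oplus Z B) at h
      have hB := (tredIn_jump_haltTime B).trans h
      have hW := h1.trans ((tredIn_oplus_left Z B).oplus hB)
      exact not_tredIn_jump _ (h2.trans (hW.oplus hB))
    · change TRedIn _ (oplus (haltTime B) B) at h
      exact not_tredIn_jump _ (h3 _ (h.trans ((tredIn_haltTime_jump B).oplus
        (TRedIn.self_jump B))) (.refl _))
  | succ n ih =>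
    obtain ⟨X, Y, hX, hY, hXY, hYX⟩ := ih (jump B)
    have key : ∀ {X Y X' Y' : ℕ → ℕ}, ¬ TRedIn X (jumpIter (oplus Y (jump B)) n) →
        TRedIn X (oplus X' (jump B)) → TRedIn (jump (oplus Y' B)) (oplus Y (jump B)) →
        ¬ TRedIn X' (jumpIter (oplus Y' B) (n + 1)) := by
      intro X Y X' Y' h h1 h2 h3
      rw [← jumpIter_jump] at h3
      have hB := (tredIn_oplus_right Y' B).jump.trans (TRedIn.self_jumpIter _ n)
      exact h ((h1.trans (h3.oplus hB)).trans (h2.jumpIter n))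
    obtain ⟨X', hX', h1, h2⟩ := hX.exists_lift
    obtain ⟨Y', hY', h3, h4⟩ := hY.exists_lift
    exact ⟨X', Y', hX', hY', key hXY h1 h4, key hYX h3 h2⟩

/-- For every `n` there exist `Π⁰₁` singletons `X, Y` with `X ≰_T Y⁽ⁿ⁾` and `Y ≰_T X⁽ⁿ⁾`. -/
theorem pi01_singletons_incomparable_up_to_nth_jump (n : ℕ) :
    ∃ X Y : ℕ → ℕ, IsPi01 {X} ∧ IsPi01 {Y} ∧
      ¬ TRedIn X (jumpIter Y n) ∧ ¬ TRedIn Y (jumpIter X n) := by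
  obtain ⟨X, Y, hX, hY, h1, h2⟩ := exists_isPi01Singleton_incomparable n zeroF
  exact ⟨X, Y, hX.isPi01, hY.isPi01, fun h => h1 (h.trans ((tredIn_oplus_left _ _).jumpIter n)),
    fun h => h2 (h.trans ((tredIn_oplus_left _ _).jumpIter n))⟩

end Harrington
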